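/- arXiv:1508.03849 — 3 statements merged into one kernel-verified Lean document; each statement's English description precedes it below -/
import Mathlib

section
/- Let G be a group satisfying hypothesis (H*). Then there exists a normal subgroup N of G such that: N is commutative; every element n of N satisfies n^9 = 1 (so N is a 3-group of exponent at most 9); there exists a subgroup C of G with N ⊓ C = ⊥ and N ⊔ C = ⊤ (C is a complement of N in G); C is a locally cyclic 2-group; and for every c ∈ C with c ≠ 1 and every n ∈ N with n ≠ 1 one has c * n * c⁻¹ ≠ n (C acts regularly on N). -/
/-- A group `K` is a locally cyclic 2-group: every element has order a power of 2
and every finitely generated subgroup is cyclic. -/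
def IsLocallyCyclic2Group (K : Type*) [Group K] : Prop :=
  (∀ k : K, ∃ n : ℕ, orderOf k = 2 ^ n) ∧
  ∀ S : Subgroup K, S.FG → IsCyclic S

/-- Hypothesis (H): `G` is periodic, `π(G) = {2, 3}`, and the order of the product of
any two elements of order at most 4 does not exceed 9. -/
def HypH (G : Type*) [Group G] : Prop :=
  (∀ g : G, IsOfFinOrder g) ∧
  (∀ p : ℕ, p.Prime → ((∃ g : G, p ∣ orderOf g) ↔ p = 2 ∨ p = 3)) ∧
  ∀ x y : G, orderOf x ≤ 4 → orderOf y ≤ 4 → orderOf (x * y) ≤ 9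

/-- Hypothesis (H*): `G` satisfies (H) and the centralizer of every involution of `G`
is a locally cyclic 2-group. -/
def HypHStar (G : Type*) [Group G] : Prop :=
  HypH G ∧ ∀ a : G, a ≠ 1 → a ^ 2 = 1 →
    IsLocallyCyclic2Group (Subgroup.centralizer {a})

namespace HStar

def IsInv {G : Type*} [Group G] (a : G) : Prop := a ≠ 1 ∧ a * a = 1

section basics
variable {G : Type*} [Group G]

theorem IsInv.inv {a : G} (h : IsInv a) : a⁻¹ = a := inv_eq_of_mul_eq_one_left h.2

theorem IsInv.cancel {a : G} (h : IsInv a) (x : G) : a * (a * x) = x := by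
  rw [← mul_assoc, h.2, one_mul]

theorem IsInv.order {a : G} (h : IsInv a) : orderOf a = 2 :=
  orderOf_eq_prime (by rw [pow_two]; exact h.2) h.1

theorem IsInv.conj {a : G} (h : IsInv a) (g : G) : IsInv (g * a * g⁻¹) := by
  refine ⟨?_, ?_⟩
  · intro h1
    exact h.1 (conj_eq_one_iff.mp h1)
  · have : g * a * g⁻¹ * (g * a * g⁻¹) = g * (a * a) * g⁻¹ := by group
    rw [this, h.2]; group

theorem IsInv.conj2 {a : G} (h : IsInv a) (g : G) : IsInv (g⁻¹ * a * g) := by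
  simpa using h.conj g⁻¹

theorem isInv_of_order {a : G} (h : orderOf a = 2) : IsInv a := by
  refine ⟨?_, ?_⟩
  · rintro rfl; simp at h
  · rw [← pow_two, ← h, pow_orderOf_eq_one]

theorem cen_cyc (hG : HypHStar G) {a : G} (ha : IsInv a) {x y : G} (hx : Commute a x)
    (hy : Commute a y) : ∃ t : G, x ∈ Subgroup.zpowers t ∧ y ∈ Subgroup.zpowers t ∧
      ∃ n, orderOf t = 2 ^ n := by
  obtain ⟨h1, h2⟩ := hG.2 a ha.1 (by rw [pow_two]; exact ha.2)
  have hx' : x ∈ Subgroup.centralizer {a} := by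
    rw [Subgroup.mem_centralizer_singleton_iff]; exact hx.eq.symm
  have hy' : y ∈ Subgroup.centralizer {a} := by
    rw [Subgroup.mem_centralizer_singleton_iff]; exact hy.eq.symm
  let X : Subgroup.centralizer {a} := ⟨x, hx'⟩
  let Y : Subgroup.centralizer {a} := ⟨y, hy'⟩
  have hc := h2 (Subgroup.closure {X, Y}) ((Subgroup.fg_iff _).2 ⟨{X, Y}, rfl, by simp⟩)
  obtain ⟨⟨⟨t, ht'⟩, ht⟩, hgen⟩ := hc.exists_generator
  refine ⟨t, ?_, ?_, ?_⟩
  · obtain ⟨k, hk⟩ := hgen ⟨X, Subgroup.subset_closure (by simp)⟩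
    refine ⟨k, ?_⟩
    have := congrArg (Subgroup.subtype _) (congrArg (Subgroup.subtype _) hk)
    simpa using this
  · obtain ⟨k, hk⟩ := hgen ⟨Y, Subgroup.subset_closure (by simp)⟩
    refine ⟨k, ?_⟩
    have := congrArg (Subgroup.subtype _) (congrArg (Subgroup.subtype _) hk)
    simpa using this
  · obtain ⟨n, hn⟩ := h1 ⟨t, ht'⟩
    exact ⟨n, by rw [← hn, Subgroup.orderOf_mk]⟩

theorem cen_two (hG : HypHStar G) {a : G} (ha : IsInv a) {x : G} (hx : Commute a x) :
    ∃ n, orderOf x = 2 ^ n := by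
  obtain ⟨t, ⟨k, rfl⟩, -, n, hn⟩ := cen_cyc hG ha hx hx
  have : orderOf (t ^ k) ∣ 2 ^ n := hn ▸ orderOf_dvd_of_mem_zpowers ⟨k, rfl⟩
  obtain ⟨m, -, hm⟩ := (Nat.dvd_prime_pow Nat.prime_two).1 this
  exact ⟨m, hm⟩

theorem mem_of_dvd {t x y : G} {n : ℕ} (hn : 0 < n) (ht : orderOf t = n)
    (hx : x ∈ Subgroup.zpowers t) (hy : y ∈ Subgroup.zpowers t)
    (h : orderOf y ∣ orderOf x) : y ∈ Subgroup.zpowers x := by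
  obtain ⟨k, rfl⟩ := (isOfFinOrder_iff_pow_eq_one.2 ⟨n, hn, ht ▸ pow_orderOf_eq_one t⟩ :
    IsOfFinOrder t).mem_powers_iff_mem_zpowers.2 hx
  obtain ⟨l, rfl⟩ := (isOfFinOrder_iff_pow_eq_one.2 ⟨n, hn, ht ▸ pow_orderOf_eq_one t⟩ :
    IsOfFinOrder t).mem_powers_iff_mem_zpowers.2 hy
  simp only at *
  have hpos : 0 < orderOf t := ht ▸ hn
  have hk : orderOf (t ^ k) * (orderOf t).gcd k = orderOf t := by
    rw [(isOfFinOrder_iff_pow_eq_one.2 ⟨n, hn, ht ▸ pow_orderOf_eq_one t⟩).orderOf_pow]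
    exact Nat.div_mul_cancel (Nat.gcd_dvd_left _ _)
  have hl : orderOf (t ^ l) * (orderOf t).gcd l = orderOf t := by
    rw [(isOfFinOrder_iff_pow_eq_one.2 ⟨n, hn, ht ▸ pow_orderOf_eq_one t⟩).orderOf_pow]
    exact Nat.div_mul_cancel (Nat.gcd_dvd_left _ _)
  have hd : (orderOf t).gcd k ∣ l := by
    obtain ⟨c, hc⟩ := h
    have h0 : 0 < orderOf (t ^ l) := by
      rcases Nat.eq_zero_or_pos (orderOf (t ^ l)) with h | h
      · rw [h] at hl; omega
      · exact h
    have : (orderOf t).gcd l = (orderOf t).gcd k * c := by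
      apply Nat.eq_of_mul_eq_mul_left h0
      rw [hl, ← mul_assoc, mul_right_comm, ← hc, hk]
    exact (Dvd.intro _ this.symm).trans (Nat.gcd_dvd_right _ _)
  obtain ⟨c, rfl⟩ := hd
  rw [pow_mul]
  apply Subgroup.pow_mem
  have hb := Nat.gcd_eq_gcd_ab (orderOf t) k
  have hb2 : t ^ (orderOf t).gcd k = (t ^ k) ^ ((orderOf t).gcdB k) := by
    rw [← zpow_natCast t ((orderOf t).gcd k), hb, zpow_add, zpow_mul, zpow_natCast,
      pow_orderOf_eq_one, one_zpow, one_mul, zpow_mul, zpow_natCast]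
  rw [hb2]
  exact ⟨_, rfl⟩

theorem cen_mem (hG : HypHStar G) {a : G} (ha : IsInv a) {x y : G} (hx : Commute a x)
    (hy : Commute a y) (h : orderOf y ∣ orderOf x) : ∃ k < orderOf x, y = x ^ k := by
  obtain ⟨t, h1, h2, n, hn⟩ := cen_cyc hG ha hx hy
  have h3 := mem_of_dvd (by positivity) hn h1 h2 h
  have hf : IsOfFinOrder x := hG.1.1 x
  obtain ⟨k, rfl⟩ := hf.mem_powers_iff_mem_zpowers.2 h3
  exact ⟨k % orderOf x, Nat.mod_lt _ hf.orderOf_pos, by simp [pow_mod_orderOf]⟩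

theorem inv_uniq (hG : HypHStar G) {a b : G} (ha : IsInv a) (hb : IsInv b) (h : Commute a b) :
    b = a := by
  obtain ⟨k, hk, h1⟩ := cen_mem hG ha (Commute.refl a) h (by rw [ha.order, hb.order])
  rw [ha.order] at hk
  interval_cases k
  · exact absurd (by simpa using h1) hb.1
  · simpa using h1

/-- An element of even order is a 2-element. -/
theorem even_twopow (hG : HypHStar G) {w : G} (h : 2 ∣ orderOf w) : ∃ n, orderOf w = 2 ^ n := by
  obtain ⟨m, hm⟩ := h
  have hpos : 0 < orderOf w := (hG.1.1 w).orderOf_pos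
  have hz : orderOf (w ^ m) = 2 := by
    rw [orderOf_pow_of_dvd (by omega) (Dvd.intro_left _ hm.symm), hm]
    exact Nat.mul_div_cancel _ (by omega)
  exact cen_two hG (isInv_of_order hz) (Commute.pow_self w m)

theorem ord_cases (hG : HypHStar G) {w : G} (h : orderOf w ≤ 9) :
    (orderOf w = 2 ∨ orderOf w = 4 ∨ orderOf w = 8) ∨ w ^ 9 = 1 := by
  have hpos : 0 < orderOf w := (hG.1.1 w).orderOf_pos
  have key : ∀ p : ℕ, p.Prime → p ∣ orderOf w → p = 2 ∨ p = 3 :=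
    fun p hp hd => (hG.1.2.1 p hp).1 ⟨w, hd⟩
  by_cases he : 2 ∣ orderOf w
  · left
    obtain ⟨n, hn⟩ := even_twopow hG he
    have : n < 4 := by
      by_contra hc
      have := Nat.pow_le_pow_right (n := 2) (by norm_num) (not_lt.1 hc)
      omega
    interval_cases n <;> simp_all
  · right
    have h5 := key 5 (by norm_num)
    have h7 := key 7 (by norm_num)
    apply orderOf_dvd_iff_pow_eq_one.1
    generalize orderOf w = m at *
    interval_cases m <;> simp_all

theorem two_cases (hG : HypHStar G) {a s : G} (ha : IsInv a) (hs : Commute a s)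
    (h : orderOf s ≤ 9) : s = 1 ∨ s = a ∨ orderOf s = 4 ∨ orderOf s = 8 := by
  obtain ⟨n, hn⟩ := cen_two hG ha hs
  have : n < 4 := by
    by_contra hc
    have := Nat.pow_le_pow_right (n := 2) (by norm_num) (not_lt.1 hc)
    omega
  interval_cases n
  · left; simpa using hn
  · right; left; exact inv_uniq hG ha (isInv_of_order (by simpa using hn)) hs
  · right; right; left; simpa using hn
  · right; right; right; simpa using hn

theorem inv_mul_pow {a b : G} (ha : IsInv a) (hb : IsInv b) (m : ℕ) :
    a * (a * b) ^ m * a = ((a * b) ^ m)⁻¹ := by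
  have h : a * (a * b) * a⁻¹ = (a * b)⁻¹ := by
    rw [mul_inv_rev, ha.inv, hb.inv, ha.cancel]
  calc a * (a * b) ^ m * a = a * (a * b) ^ m * a⁻¹ := by rw [ha.inv]
    _ = (a * (a * b) * a⁻¹) ^ m := by rw [conj_pow]
    _ = _ := by rw [h, inv_pow]

theorem ab9 (hG : HypHStar G) {a b : G} (ha : IsInv a) (hb : IsInv b) : (a * b) ^ 9 = 1 := by
  have hle := hG.1.2.2 a b (by rw [ha.order]; norm_num) (by rw [hb.order]; norm_num)
  by_cases he : 2 ∣ orderOf (a * b)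
  · exfalso
    obtain ⟨m, hm⟩ := he
    have hpos : 0 < orderOf (a * b) := (hG.1.1 _).orderOf_pos
    have hz : orderOf ((a * b) ^ m) = 2 := by
      rw [orderOf_pow_of_dvd (by omega) (Dvd.intro_left _ hm.symm), hm]
      exact Nat.mul_div_cancel _ (by omega)
    have hzi := isInv_of_order hz
    have h1 := inv_mul_pow ha hb m
    rw [hzi.inv] at h1
    have hc : Commute a ((a * b) ^ m) := by
      show a * _ = _ * a
      conv_rhs => rw [← h1]
      rw [mul_assoc _ a a, ha.2, mul_one]
    have h2 := inv_uniq hG ha hzi hc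
    have hc2 : Commute a b := by
      have h3 : Commute ((a * b) ^ m) (a * b) := Commute.pow_self _ _
      rw [h2] at h3
      have h4 : a * (a * b) = a * b * a := h3
      have : a * b = b * a := by
        apply mul_left_cancel (a := a); rw [h4, mul_assoc]
      exact this
    have h5 := inv_uniq hG ha hb hc2
    rw [h5, ha.2] at hm
    simp at hm
    omega
  · rcases ord_cases hG hle with h | h
    · omega
    · exact h

theorem not_inv_of_nine {p : G} (h : IsInv p) (h9 : p ^ 9 = 1) : False := by
  apply h.1
  have : p ^ 9 = p * ((p * p) * (p * p) * (p * p) * (p * p)) := by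
    simp only [pow_succ, pow_zero, one_mul, mul_assoc]
  rw [h.2] at this
  rw [← h9, this]; simp

/-- midpoints -/
theorem mid (hG : HypHStar G) {r : G} (hr : IsInv r) (g : G) :
    ∃ e, IsInv e ∧ Commute r (g * e) := by
  have hr' := hr.conj2 g
  have h9 := ab9 hG hr hr'
  have hp := inv_mul_pow hr hr' 5
  set p := r * (g⁻¹ * r * g) with hpdef
  have he : IsInv (r * p ^ 5) := by
    have h2 : r * p ^ 5 * (r * p ^ 5) = 1 := by
      rw [← mul_assoc, hp]; group
    refine ⟨?_, h2⟩
    intro h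
    have h3 : p ^ 5 = r := by
      rw [← hr.inv]; exact (inv_eq_of_mul_eq_one_right h).symm
    apply not_inv_of_nine hr
    rw [← h3, ← pow_mul, mul_comm, pow_mul, h9, one_pow]
  refine ⟨_, he, ?_⟩
  have h1 : r * p ^ 5 * r * (r * p ^ 5) = r * p := by
    rw [mul_assoc (r * p ^ 5), hr.cancel, mul_assoc, ← pow_add]
    rw [show 5 + 5 = 9 + 1 from rfl, pow_succ, h9, one_mul]
  have h2 : r * p = g⁻¹ * r * g := hr.cancel _
  generalize r * p ^ 5 = e at *
  show r * (g * e) = g * e * r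
  have h3 : r * g = g * (g⁻¹ * r * g) := by group
  rw [← mul_assoc, h3, ← h2, ← h1]
  have : g * (e * r * e) * e = g * e * r * (e * e) := by group
  rw [this, he.2, mul_one]

theorem no_S4 (hG : HypHStar G) {a w : G} (ha : IsInv a) (hw : orderOf w = 4)
    (h : (a * w) ^ 3 = 1) : False := by
  have hw4 : w ^ 4 = 1 := hw ▸ pow_orderOf_eq_one w
  have hz : IsInv (w ^ 2) := isInv_of_order (by
    rw [orderOf_pow_of_dvd (by norm_num) (by rw [hw]; norm_num), hw])
  have e1 : a * w * a = w⁻¹ * a * w⁻¹ := by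
    have : a * w * a * (w * a * w) = 1 := by
      rw [← h]; simp only [pow_succ, pow_zero, one_mul, mul_assoc]
    rw [eq_inv_of_mul_eq_one_left this, mul_inv_rev, mul_inv_rev, ha.inv, mul_assoc]
  have e2 : w * a * w = a * w⁻¹ * a := by
    have : w * a * w * (a * w * a) = 1 := by
      have h' : a * (w * a * w * (a * w * a)) * a⁻¹ = 1 := by
        rw [← h, ha.inv]
        have : a * (w * a * w * (a * w * a)) * a = (a * w) ^ 3 * (a * a) := by
          simp only [pow_succ, pow_zero, one_mul, mul_assoc]
        rw [this, ha.2, mul_one]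
      exact conj_eq_one_iff.mp h'
    rw [eq_inv_of_mul_eq_one_left this, mul_inv_rev, mul_inv_rev, ha.inv, mul_assoc]
  have e3 : (w ^ 2 * a) ^ 4 = 1 := by
    calc (w ^ 2 * a) ^ 4 = w * (w * a * w) * w * a * (w * (w * a * w) * w) * a := by
          simp only [pow_succ, pow_zero, one_mul, mul_assoc]
      _ = w * a * w⁻¹ * (a * w * a) * w * a * w⁻¹ * a * w * a := by
          rw [e2]; simp only [mul_assoc]
      _ = w * a * w⁻¹ * w⁻¹ * (a * a) * w⁻¹ * a * w * a := by
          rw [e1]; group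
      _ = w * a * (w ^ 4)⁻¹ * w * a * w * a := by rw [ha.2]; group
      _ = w * a * (w * a * w) * a := by rw [hw4]; group
      _ = w * (a * a) * w⁻¹ * (a * a) := by rw [e2]; group
      _ = 1 := by rw [ha.2]; group
  have h9 := ab9 hG hz ha
  have h1 : w ^ 2 * a = 1 := by
    rw [show 9 = 4 + 4 + 1 from rfl, pow_succ, pow_add, e3] at h9
    simpa using h9
  have h2 : a = w ^ 2 := by
    rw [← hz.inv]; exact (inv_eq_of_mul_eq_one_right h1).symm
  rw [h2, ← pow_succ, ← pow_mul, show (2 + 1) * 3 = 4 + 4 + 1 from rfl, pow_succ, pow_add, hw4] at h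
  simp at h
  rw [h] at hw
  simp at hw

/-- The centralizer of an inverted element is inverted. -/
theorem cen_inverted (hG : HypHStar G) {b v g : G} (hb : IsInv b) (hv3 : v ^ 3 = 1) (hv1 : v ≠ 1)
    (hbv : b * v * b = v⁻¹) (hg : Commute v g) : b * g * b = g⁻¹ := by
  have hbi := hb.inv
  have hgb := hb.conj g
  have h9 := ab9 hG hgb hb
  have hinv := inv_mul_pow hgb hb 5
  set h := g * b * g⁻¹ * b with hh
  have hvb : b * v⁻¹ * b = v := by
    rw [← hbv]
    have : b * (b * v * b) * b = b * b * v * (b * b) := by group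
    rw [this, hb.2]; simp
  have hc : Commute v h := by
    show v * h = h * v
    have e : v * g = g * v := hg
    have e' : v⁻¹ * g⁻¹ = g⁻¹ * v⁻¹ := (hg.inv_inv).eq
    have c1 : v * b = b * v⁻¹ := by
      rw [← hbv, mul_assoc b v b, hb.cancel]
    have c2 : v⁻¹ * b = b * v := by
      conv_rhs => rw [← hvb]
      rw [mul_assoc b v⁻¹ b, hb.cancel]
    calc v * (g * b * g⁻¹ * b) = v * g * b * g⁻¹ * b := by group
      _ = g * (v * b) * g⁻¹ * b := by rw [e]; group
      _ = g * b * (v⁻¹ * g⁻¹) * b := by rw [c1]; group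
      _ = g * b * g⁻¹ * (v⁻¹ * b) := by rw [e']; group
      _ = g * b * g⁻¹ * b * v := by rw [c2]; group
  have hbh : b * h * b⁻¹ = h⁻¹ := by
    rw [hh]; simp only [mul_inv_rev, inv_inv, hbi]
    have : b * (g * b * g⁻¹ * b) * b = b * (g * (b * g⁻¹)) * (b * b) := by group
    rw [this, hb.2, mul_one]
  have hbk : b * h ^ 5 * b⁻¹ = (h ^ 5)⁻¹ := by rw [← conj_pow, hbh, inv_pow]
  have hk2 : h ^ 5 * h ^ 5 = h := by
    rw [← pow_add, show 5 + 5 = 9 + 1 from rfl, pow_succ, h9, one_mul]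
  have hkv : Commute v (h ^ 5) := hc.pow_right 5
  have hgg : b * g * b⁻¹ = h⁻¹ * g := by
    rw [hh]; simp only [mul_inv_rev, inv_inv, hbi]; group
  generalize h ^ 5 = k at *
  -- c = k⁻¹ g commutes with b and v
  have hcb : Commute b (k⁻¹ * g) := by
    have : b * (k⁻¹ * g) * b⁻¹ = k⁻¹ * g := by
      calc b * (k⁻¹ * g) * b⁻¹ = (b * k * b⁻¹)⁻¹ * (b * g * b⁻¹) := by group
        _ = k⁻¹ * g := by rw [hbk, hgg, ← hk2]; group
    show b * (k⁻¹ * g) = k⁻¹ * g * b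
    exact mul_inv_eq_iff_eq_mul.1 this
  have hcv : Commute v (k⁻¹ * g) := (hkv.inv_right).mul_right hg
  have hc1 : k⁻¹ * g = 1 := by
    by_contra hne
    obtain ⟨n, hn⟩ := cen_two hG hb hcb
    have hn0 : n ≠ 0 := by rintro rfl; apply hne; simpa using hn
    obtain ⟨m, rfl⟩ := Nat.exists_eq_succ_of_ne_zero hn0
    have ho : orderOf ((k⁻¹ * g) ^ 2 ^ m) = 2 := by
      rw [orderOf_pow_of_dvd (by positivity) (by rw [hn]; exact pow_dvd_pow _ (by omega)), hn,
        pow_succ]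
      exact Nat.mul_div_cancel_left _ (by positivity)
    have hz := inv_uniq hG hb (isInv_of_order ho) (hcb.pow_right _)
    have hvb' : Commute v b := hz ▸ hcv.pow_right (2 ^ m)
    have h1 : v⁻¹ = v := by
      rw [← hbv, mul_assoc, hvb'.eq, hb.cancel]
    apply hv1
    have : v ^ 3 = v * v⁻¹ * v := by
      rw [h1]; simp only [pow_succ, pow_zero, one_mul, mul_assoc]
    rw [← hv3, this]; group
  have : g = k := by
    rw [← inv_inv k]; exact (inv_eq_of_mul_eq_one_right hc1).symm
  rw [this, ← hbk, hbi]

theorem cen_comm (hG : HypHStar G) {b v g g' : G} (hb : IsInv b) (hv3 : v ^ 3 = 1) (hv1 : v ≠ 1)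
    (hbv : b * v * b = v⁻¹) (hg : Commute v g) (hg' : Commute v g') : Commute g g' := by
  have h1 := cen_inverted hG hb hv3 hv1 hbv hg
  have h2 := cen_inverted hG hb hv3 hv1 hbv hg'
  have h3 := cen_inverted hG hb hv3 hv1 hbv (hg'.mul_right hg)
  have h4 : b * (g' * g) * b = (b * g' * b) * (b * g * b) := by
    have : (b * g' * b) * (b * g * b) = b * g' * (b * b) * g * b := by group
    rw [this, hb.2]; group
  rw [h4, h1, h2, ← mul_inv_rev] at h3
  exact inv_injective h3

theorem mid_conj (hG : HypHStar G) {r r' : G} (hr : IsInv r) (hr' : IsInv r') :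
    ∃ e, IsInv e ∧ e * r * e = r' := by
  have h9 := ab9 hG hr hr'
  have hp := inv_mul_pow hr hr' 5
  set p := r * r' with hpdef
  have he : r * p ^ 5 * (r * p ^ 5) = 1 := by
    rw [← mul_assoc, hp]; group
  have h1 : r * p ^ 5 * r * (r * p ^ 5) = r' := by
    rw [mul_assoc (r * p ^ 5), hr.cancel, mul_assoc, ← pow_add,
      show 5 + 5 = 9 + 1 from rfl, pow_succ, h9, one_mul]
    exact hr.cancel _
  refine ⟨_, ⟨?_, he⟩, h1⟩
  intro h
  have h3 : p ^ 5 = r := by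
    rw [← hr.inv]; exact (inv_eq_of_mul_eq_one_right h).symm
  apply not_inv_of_nine hr
  rw [← h3, ← pow_mul, mul_comm, pow_mul, h9, one_pow]

theorem pow_eq_inv (hG : HypHStar G) {a c : G} (ha : IsInv a) (hc : Commute a c) (h1 : c ≠ 1) :
    ∃ m : ℕ, c ^ m = a := by
  obtain ⟨n, hn⟩ := cen_two hG ha hc
  have hn0 : n ≠ 0 := by rintro rfl; apply h1; simpa using hn
  obtain ⟨m, rfl⟩ := Nat.exists_eq_succ_of_ne_zero hn0
  have ho : orderOf (c ^ 2 ^ m) = 2 := by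
    rw [orderOf_pow_of_dvd (by positivity) (by rw [hn]; exact pow_dvd_pow _ (by omega)), hn,
      pow_succ]
    exact Nat.mul_div_cancel_left _ (by positivity)
  exact ⟨_, inv_uniq hG ha (isInv_of_order ho) (hc.pow_right _)⟩

theorem not_four_nine {k : G} (h : orderOf k = 4) (h9 : k ^ 9 = 1) : False := by
  have := orderOf_dvd_of_pow_eq_one h9
  rw [h] at this
  omega

theorem four_roots (hG : HypHStar G) {i s : G} (hi : orderOf i = 4) (hs : orderOf s = 4)
    (hr : IsInv (i ^ 2)) (hc : Commute (i ^ 2) s) : s = i ∨ s = i⁻¹ := by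
  obtain ⟨k, hk, h⟩ := cen_mem hG hr (Commute.pow_self i 2) hc (by rw [hi, hs])
  have hi4 : i ^ 4 = 1 := hi ▸ pow_orderOf_eq_one i
  rw [hi] at hk
  interval_cases k
  · rw [h] at hs; simp at hs
  · left; simpa using h
  · rw [h, hr.order] at hs; omega
  · right; rw [h]; apply eq_inv_of_mul_eq_one_left; rw [← pow_succ, hi4]

theorem pow9_swap {s e : G} (he : IsInv e) (h : (s⁻¹ * e) ^ 9 = 1) : (s * e) ^ 9 = 1 := by
  have h1 : e * (s⁻¹ * e) * e⁻¹ = (s * e)⁻¹ := by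
    rw [mul_inv_rev, he.inv]
    have : e * (s⁻¹ * e) * e = e * s⁻¹ * (e * e) := by group
    rw [this, he.2, mul_one]
  have h2 : ((s * e)⁻¹) ^ 9 = 1 := by rw [← h1, conj_pow, h]; simp
  rw [inv_pow] at h2
  simpa using h2

theorem claimX (hG : HypHStar G) {i d : G} (hi : orderOf i = 4) (hd : IsInv d)
    (h3 : (i ^ 2 * d) ^ 3 = 1) : (i * d) ^ 4 = 1 := by
  have hi4 : i ^ 4 = 1 := hi ▸ pow_orderOf_eq_one i
  have hr : IsInv (i ^ 2) := isInv_of_order (by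
    rw [orderOf_pow_of_dvd (by norm_num) (by rw [hi]; norm_num), hi])
  have hle := hG.1.2.2 i d (by rw [hi]) (by rw [hd.order]; norm_num)
  rcases ord_cases hG hle with (h | h | h) | h
  · exact orderOf_dvd_iff_pow_eq_one.1 (by rw [h]; norm_num)
  · exact orderOf_dvd_iff_pow_eq_one.1 (by rw [h])
  · exfalso
    have h4 : orderOf ((i * d) ^ 2) = 4 := by
      rw [orderOf_pow_of_dvd (by norm_num) (by rw [h]; norm_num), h]
    apply no_S4 hG (hd.conj i) h4
    rw [← h3]
    congr 1
    rw [pow_two, pow_two]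
    have : i * d * i⁻¹ * (i * d * (i * d)) = i * (d * d) * i * d := by group
    rw [this, hd.2, mul_one]
  · exfalso
    have hk : orderOf (d * i * d) = 4 := by
      rw [← hi]
      have : d * i * d = d * i * d⁻¹ := by rw [hd.inv]
      rw [this]
      exact (orderOf_injective (MulAut.conj d).toMonoidHom (MulAut.conj d).injective i)
    obtain ⟨e, he, hc⟩ := mid hG hr (d * i * d)
    have hk9 := not_four_nine hk
    have hsle := hG.1.2.2 (d * i * d) e (by rw [hk]) (by rw [he.order]; norm_num)
    have hw1 : (i⁻¹ * (d * i * d)) ^ 9 = 1 := by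
      have : i⁻¹ * (d * i * d) = i⁻¹ * d * i * d := by group
      rw [this]; exact ab9 hG (hd.conj2 i) hd
    have hw2 : (i * (d * i * d)) ^ 9 = 1 := by
      have : i * (d * i * d) = (i * d) ^ 2 := by rw [pow_two]; group
      rw [this, ← pow_mul, mul_comm, pow_mul, h, one_pow]
    generalize d * i * d = k at *
    obtain ⟨s, hs⟩ : ∃ s, s = k * e := ⟨_, rfl⟩
    have hks : k = s * e := by rw [hs, mul_assoc, he.2, mul_one]
    rw [← hs] at hc hsle
    rcases two_cases hG hr hc hsle with h1 | h1 | h1 | h1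
    · rw [h1, one_mul] at hks
      rw [hks, he.order] at hk; omega
    · rw [h1] at hks
      apply hk9; rw [hks]; exact ab9 hG hr he
    · rcases four_roots hG hi h1 hr hc with h2 | h2
      · apply not_inv_of_nine he
        rw [← hw1, hks, h2]; group
      · apply not_inv_of_nine he
        rw [← hw2, hks, h2]; group
    · have h4 : orderOf (s ^ 2) = 4 := by
        rw [orderOf_pow_of_dvd (by norm_num) (by rw [h1]; norm_num), h1]
      rcases four_roots hG hi h4 hr (hc.pow_right 2) with h2 | h2
      · apply hk9; rw [hks]; apply pow9_swap he
        rw [← hw1, hks, ← h2]; group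
      · apply hk9; rw [hks]; apply pow9_swap he
        have h5 : i = (s ^ 2)⁻¹ := by rw [h2, inv_inv]
        rw [← hw2, hks, h5]; group

theorem lemQ (hG : HypHStar G) {q v : G} (hq : IsInv q) (hv3 : v ^ 3 = 1) (hv1 : v ≠ 1)
    (hqv : q * v * q ≠ v⁻¹) : ∃ s e, IsInv e ∧ Commute q s ∧ orderOf s = 8 ∧ v = s * e := by
  have hov : orderOf v = 3 := orderOf_eq_prime hv3 hv1
  obtain ⟨e, he, hc⟩ := mid hG hq v
  have hsle := hG.1.2.2 v e (by rw [hov]; norm_num) (by rw [he.order]; norm_num)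
  obtain ⟨s, hs⟩ : ∃ s, s = v * e := ⟨_, rfl⟩
  have hvs : v = s * e := by rw [hs, mul_assoc, he.2, mul_one]
  rw [← hs] at hc hsle
  rcases two_cases hG hq hc hsle with h1 | h1 | h1 | h1
  · rw [h1, one_mul] at hvs
    rw [hvs, he.order] at hov; omega
  · exfalso; apply hqv
    rw [hvs, h1, mul_inv_rev, he.inv, hq.inv, hq.cancel]
  · exfalso
    apply no_S4 hG he (w := s⁻¹) (by rw [orderOf_inv, h1])
    have : e * s⁻¹ = v⁻¹ := by rw [hvs, mul_inv_rev, he.inv]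
    rw [this, inv_pow, hv3, inv_one]
  · exact ⟨s, e, he, hc, h1, hvs⟩

theorem lemP (hG : HypHStar G) {r v1 v2 s e1 e2 : G} (hr : IsInv r) (h13 : v1 ^ 3 = 1)
    (h23 : v2 ^ 3 = 1) (hr1 : r * v1 * r = v1⁻¹) (hr2 : r * v2 * r = v2⁻¹) (hc : Commute v1 v2)
    (hne : v1 ≠ v2) (he1 : IsInv e1) (he2 : IsInv e2) (hs : orderOf s = 8)
    (h1 : v1 = s * e1) (h2 : v2 = s * e2) : False := by
  obtain ⟨w, hw⟩ : ∃ w, w = v1⁻¹ * v2 := ⟨_, rfl⟩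
  have hw3 : w ^ 3 = 1 := by
    rw [hw, hc.inv_left.mul_pow, inv_pow, h13, h23]; simp
  have hw1 : w ≠ 1 := by
    rw [hw]; intro h; exact hne (inv_mul_eq_one.1 h)
  have hwe : w = e1 * e2 := by
    rw [hw, h1, h2, mul_inv_rev, he1.inv]; group
  have hew : e1 * w * e1 = w⁻¹ := by
    rw [hwe, mul_inv_rev, he1.inv, he2.inv, he1.cancel]
  have hcw : Commute w v1 := by
    rw [hw]; exact ((Commute.refl v1).inv_left).mul_left hc.symm
  have h5 := cen_inverted hG he1 hw3 hw1 hew hcw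
  have h6 : s ^ 2 = 1 := by
    have hsv : s = v1 * e1 := by rw [h1, mul_assoc, he1.2, mul_one]
    rw [hsv, pow_two]
    have : v1 * e1 * (v1 * e1) = v1 * (e1 * v1 * e1) := by group
    rw [this, h5]; group
  have := orderOf_dvd_of_pow_eq_one h6
  rw [hs] at this; omega

theorem lemPP (hG : HypHStar G) {r v1 v2 s s' e1 e2 : G} (hr : IsInv r) (h13 : v1 ^ 3 = 1)
    (h23 : v2 ^ 3 = 1) (hr1 : r * v1 * r = v1⁻¹) (hr2 : r * v2 * r = v2⁻¹) (hc : Commute v1 v2)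
    (hne : v1 ≠ v2) (hne' : v1 * v2 ≠ 1) (he1 : IsInv e1) (he2 : IsInv e2) (hs : orderOf s = 8)
    (h1 : v1 = s * e1) (h2 : v2 = s' * e2) (h : s' = s ∨ s' = s⁻¹) : False := by
  rcases h with rfl | rfl
  · exact lemP hG hr h13 h23 hr1 hr2 hc hne he1 he2 hs h1 h2
  · refine lemP hG (v2 := v2⁻¹) hr h13 (by rw [inv_pow, h23, inv_one]) hr1 ?_ hc.inv_right ?_ he1
      (he2.conj2 s) hs h1 ?_
    · have : r * v2⁻¹ * r = (r⁻¹ * v2 * r⁻¹)⁻¹ := by group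
      rw [this, hr.inv, hr2]
    · intro h; apply hne'; rw [h]; group
    · rw [h2, mul_inv_rev, he2.inv]; group

theorem stepB (hG : HypHStar G) {i d q : G} (hi : orderOf i = 4) (hd : IsInv d) (hq : IsInv q)
    (h3 : (i ^ 2 * d) ^ 3 = 1) (hne : i ^ 2 * d ≠ 1) :
    q * (i ^ 2 * d) * q = (i ^ 2 * d)⁻¹ := by
  have hi4 : i ^ 4 = 1 := hi ▸ pow_orderOf_eq_one i
  have hr : IsInv (i ^ 2) := isInv_of_order (by
    rw [orderOf_pow_of_dvd (by norm_num) (by rw [hi]; norm_num), hi])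
  have hX := claimX hG hi hd h3
  by_contra hqx
  obtain ⟨r, hrdef⟩ : ∃ r, r = i ^ 2 := ⟨_, rfl⟩
  obtain ⟨x, hx⟩ : ∃ x, x = i ^ 2 * d := ⟨_, rfl⟩
  obtain ⟨y, hy⟩ : ∃ y, y = i⁻¹ * x * i := ⟨_, rfl⟩
  have hrx : r * x * r = x⁻¹ := by
    have hr2 : IsInv r := hrdef ▸ hr
    rw [hx, ← hrdef, mul_inv_rev, hr2.inv, hd.inv, hr2.cancel]
  have hri : Commute r i := hrdef ▸ Commute.pow_self i 2
  rw [← hx] at h3 hne hqx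
  have hy3 : y ^ 3 = 1 := by
    have : y = i⁻¹ * x * (i⁻¹)⁻¹ := by rw [hy, inv_inv]
    rw [this, conj_pow, h3]; group
  have hry : r * y * r = y⁻¹ := by
    have e1 : r * i⁻¹ = i⁻¹ * r := hri.inv_right
    calc r * y * r = r * i⁻¹ * x * (i * r) := by rw [hy]; group
      _ = i⁻¹ * (r * x * r) * i := by rw [e1, ← hri.eq]; group
      _ = y⁻¹ := by rw [hrx, hy]; group
  have hrr : r * r = 1 := hrdef ▸ hr.2
  have hcxy : Commute x y := by
    have e1 : (i * d) ^ 2 = y * r * x := by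
      rw [hy, hx, hrdef, pow_two, pow_two]
      have : i⁻¹ * (i * i * d) * i * (i * i) * (i * i * d) = i * d * i * (i ^ 4) * d := by
        simp only [pow_succ, pow_zero, one_mul, mul_assoc, inv_mul_cancel_left]
      rw [this, hi4]; simp only [mul_one, mul_assoc]
    have e2 : (y * r * x) * (y * r * x) = 1 := by
      rw [← e1, ← pow_add]; exact hX
    have e3 : y * (r * x * r) * (r * y * r) * x = 1 := by
      have : y * (r * x * r) * (r * y * r) * x = y * r * x * (r * r) * y * r * x := by group
      rw [this, hrr, mul_one]
      simpa only [mul_assoc] using e2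
    rw [hrx, hry] at e3
    have e4 : y * x⁻¹ = x⁻¹ * y := by
      have : (y * x⁻¹) * (x⁻¹ * y)⁻¹ = 1 := by rw [← e3]; group
      exact mul_inv_eq_one.1 this
    have : Commute y x⁻¹ := e4
    simpa using this.inv_right.symm
  have hxx : x ≠ x⁻¹ := by
    intro h
    apply hne
    have : x ^ 3 = x * x⁻¹ * x := by
      rw [← h]; simp only [pow_succ, pow_zero, one_mul, mul_assoc]
    rw [← h3, this]; group
  -- conjugating twice
  have hyy : i⁻¹ * y * i = x⁻¹ := by
    have e : i⁻¹ * y * i = (i ^ 2)⁻¹ * x * i ^ 2 := by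
      rw [hy, pow_two, mul_inv_rev]; simp only [mul_assoc]
    rw [e, ← hrdef, inv_eq_of_mul_eq_one_left hrr, hrx]
  have hyx : y ≠ x := by
    intro h
    rw [h, ← hy, h] at hyy; exact hxx hyy
  have hyx' : y ≠ x⁻¹ := by
    intro h
    have : i⁻¹ * y * i = (i⁻¹ * x * i)⁻¹ := by rw [h]; group
    rw [this, ← hy, h, inv_inv] at hyy; exact hxx hyy
  have hy1 : y ≠ 1 := by
    intro h; rw [h] at hyy; simp at hyy; exact hne hyy
  have hxy1 : x * y ≠ 1 := fun h => hyx' (eq_inv_of_mul_eq_one_right h)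
  have hxy3 : (x * y) ^ 3 = 1 := by rw [hcxy.mul_pow, h3, hy3, one_mul]
  have hrxy : r * (x * y) * r = (x * y)⁻¹ := by
    have : (r * x * r) * (r * y * r) = r * x * (r * r) * y * r := by group
    rw [hrr, hrx, hry] at this
    rw [hcxy.eq, mul_inv_rev, this, ← hcxy.eq]; group
  have hqy : q * y * q ≠ y⁻¹ := fun h => hqx (cen_inverted hG hq hy3 hy1 h hcxy.symm)
  have hcx : Commute x (x * y) := (Commute.refl x).mul_right hcxy
  have hcy : Commute y (x * y) := hcxy.symm.mul_right (Commute.refl y)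
  have hqxy : q * (x * y) * q ≠ (x * y)⁻¹ := fun h => hqx (cen_inverted hG hq hxy3 hxy1 h hcx.symm)
  obtain ⟨t, e1, he1, ht, ht8, h1⟩ := lemQ hG hq h3 hne hqx
  obtain ⟨s2, e2, he2, hs2, hs28, h2⟩ := lemQ hG hq hy3 hy1 hqy
  obtain ⟨s3, e3, he3, hs3, hs38, h3'⟩ := lemQ hG hq hxy3 hxy1 hqxy
  have hr' : IsInv r := hrdef ▸ hr
  have t8 : t ^ 8 = 1 := ht8 ▸ pow_orderOf_eq_one t
  have hx2 : x * x = x⁻¹ := by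
    apply eq_inv_of_mul_eq_one_left
    rw [← h3]; simp only [pow_succ, pow_zero, one_mul, mul_assoc]
  have hy2 : y * y = y⁻¹ := by
    apply eq_inv_of_mul_eq_one_left
    rw [← hy3]; simp only [pow_succ, pow_zero, one_mul, mul_assoc]
  have P1 : ¬ (s2 = t ∨ s2 = t⁻¹) := fun h =>
    lemPP hG hr' h3 hy3 hrx hry hcxy hyx.symm hxy1 he1 he2 ht8 h1 h2 h
  have P2 : ¬ (s3 = t ∨ s3 = t⁻¹) := fun h =>
    lemPP hG hr' h3 hxy3 hrx hrxy hcx (by intro h; exact hy1 (by simpa using h))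
      (by rw [← mul_assoc, hx2]; intro h; exact hyx (inv_mul_eq_one.1 h).symm) he1 he3 ht8 h1 h3' h
  have P3 : ¬ (s3 = s2 ∨ s3 = s2⁻¹) := fun h =>
    lemPP hG hr' hy3 hxy3 hry hrxy hcy (by intro h; exact hne (by simpa using h))
      (by rw [hcxy.eq, ← mul_assoc, hy2]; intro h; exact hyx (inv_mul_eq_one.1 h)) he2 he3 hs28 h2 h3' h
  have odd : ∀ s, Commute q s → orderOf s = 8 → ¬ (s = t ∨ s = t⁻¹) → s = t ^ 3 ∨ s = t ^ 5 := by
    intro s hs hs8 hn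
    obtain ⟨k, hk, h⟩ := cen_mem hG hq ht hs (by rw [ht8, hs8])
    have hev : ∀ m, k ≠ 2 * m := by
      rintro m rfl
      have : s ^ 4 = 1 := by
        rw [h, ← pow_mul, show 2 * m * 4 = 8 * m by ring, pow_mul, t8, one_pow]
      have := orderOf_dvd_of_pow_eq_one this
      rw [hs8] at this; omega
    rw [ht8] at hk
    interval_cases k
    · exact absurd rfl (hev 0)
    · exact absurd (Or.inl (by simpa using h)) hn
    · exact absurd rfl (hev 1)
    · exact Or.inl h
    · exact absurd rfl (hev 2)
    · exact Or.inr h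
    · exact absurd rfl (hev 3)
    · refine absurd (Or.inr ?_) hn
      rw [h]; apply eq_inv_of_mul_eq_one_left; rw [← pow_succ, t8]
  have t35 : t ^ 3 = (t ^ 5)⁻¹ := by
    apply eq_inv_of_mul_eq_one_left; rw [← pow_add, t8]
  rcases odd s2 hs2 hs28 P1 with h2 | h2 <;> rcases odd s3 hs3 hs38 P2 with h3 | h3
  · exact P3 (Or.inl (by rw [h2, h3]))
  · exact P3 (Or.inr (by rw [h2, h3, t35, inv_inv]))
  · exact P3 (Or.inr (by rw [h2, h3, t35]))
  · exact P3 (Or.inl (by rw [h2, h3]))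

theorem triple (hG : HypHStar G) {a b c : G} (ha : IsInv a) (hb : IsInv b) (hc : IsInv c) :
    IsInv (a * b * c) := by
  by_cases h4 : ∃ i : G, orderOf i = 4
  · by_cases hab : a * b = 1
    · rw [hab, one_mul]; exact hc
    obtain ⟨i0, hi0⟩ := h4
    have hr0 : IsInv (i0 ^ 2) := isInv_of_order (by
      rw [orderOf_pow_of_dvd (by norm_num) (by rw [hi0]; norm_num), hi0])
    obtain ⟨e, he, hea⟩ := mid_conj hG hr0 ha
    obtain ⟨i, hi⟩ : ∃ i, i = e * i0 * e⁻¹ := ⟨_, rfl⟩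
    have hia : i ^ 2 = a := by rw [hi, conj_pow, he.inv, hea]
    have hi4 : orderOf i = 4 := by
      rw [hi, ← hi0]
      exact (orderOf_injective (MulAut.conj e).toMonoidHom (MulAut.conj e).injective i0)
    have h9 := ab9 hG ha hb
    obtain ⟨m, hm3, hm1⟩ : ∃ m : ℕ, ((a * b) ^ m) ^ 3 = 1 ∧ (a * b) ^ m ≠ 1 := by
      by_cases h : (a * b) ^ 3 = 1
      · exact ⟨1, by rw [pow_one, h], by rwa [pow_one]⟩
      · exact ⟨3, by rw [← pow_mul, h9], h⟩
    have hav := inv_mul_pow ha hb m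
    have huv : Commute ((a * b) ^ m) (a * b) := Commute.pow_self _ _
    generalize (a * b) ^ m = v at *
    have hd : IsInv (a * v) := by
      have h2 : a * v * (a * v) = 1 := by rw [← mul_assoc, hav]; group
      refine ⟨?_, h2⟩
      intro h
      have h3 : v = a := by
        rw [← ha.inv]; exact (inv_eq_of_mul_eq_one_right h).symm
      apply not_inv_of_nine ha
      rw [← h3, show 9 = 3 * 3 from rfl, pow_mul, hm3, one_pow]
    have hB := stepB hG hi4 hd hc (by rw [hia, ha.cancel, hm3]) (by rwa [hia, ha.cancel])
    rw [hia, ha.cancel] at hB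
    have hca : Commute v (c * a) := by
      have e1 : v * c = c * v⁻¹ := by
        rw [← hB, mul_assoc c v c, hc.cancel]
      have e2 : v⁻¹ * a = a * v := by
        rw [← hav, mul_assoc, ha.2, mul_one]
      calc v * (c * a) = v * c * a := by group
        _ = c * (v⁻¹ * a) := by rw [e1]; group
        _ = c * a * v := by rw [e2]; group
    have hcomm := cen_comm hG ha hm3 hm1 hav huv hca
    refine ⟨?_, ?_⟩
    · intro h
      have : a * b = c := by rw [← hc.inv]; exact eq_inv_of_mul_eq_one_left h
      exact not_inv_of_nine (this ▸ hc : IsInv (a * b)) h9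
    · have : a * b * c * (a * b * c) = a * b * (c * a) * (b * c) := by group
      rw [this, hcomm.eq]
      have : c * a * (a * b) * (b * c) = c * (a * a) * (b * b) * c := by group
      rw [this, ha.2, hb.2, mul_one, mul_one, hc.2]
  · obtain ⟨e, he, hce⟩ := mid hG ha (a * b * c)
    obtain ⟨s, hs⟩ : ∃ s, s = a * b * c * e := ⟨_, rfl⟩
    have hse : a * b * c = s * e := by rw [hs, mul_assoc _ e e, he.2, mul_one]
    rw [← hs] at hce
    obtain ⟨n, hn⟩ := cen_two hG ha hce
    have hn2 : n < 2 := by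
      by_contra hge
      apply h4
      refine ⟨s ^ 2 ^ (n - 2), ?_⟩
      rw [orderOf_pow_of_dvd (by positivity) (by rw [hn]; exact pow_dvd_pow _ (by omega)), hn,
        Nat.pow_div (by omega) (by norm_num), show n - (n - 2) = 2 by omega]
    interval_cases n
    · have : s = 1 := by simpa using hn
      rw [hse, this, one_mul]; exact he
    · exfalso
      have h1 := inv_uniq hG ha (isInv_of_order (by simpa using hn)) hce
      rw [h1, mul_assoc] at hse
      have h2 := mul_left_cancel hse
      exact not_inv_of_nine (h2 ▸ he : IsInv (b * c)) (ab9 hG hb hc)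

theorem rev (hG : HypHStar G) {a b c : G} (ha : IsInv a) (hb : IsInv b) (hc : IsInv c) :
    a * b * c = c * b * a := by
  rw [← (triple hG ha hb hc).inv, mul_inv_rev, mul_inv_rev, ha.inv, hb.inv, hc.inv, mul_assoc]

end basics

end HStar

open HStar
/-- Theorem 1 of the paper: a group satisfying (H*) is `O₃(G) ⋊ C` with `O₃(G)` abelian
of exponent at most 9 and `C` a locally cyclic 2-group acting regularly on `O₃(G)`. -/
theorem statement_0 (G : Type*) [Group G] (hG : HypHStar G) :
    ∃ N : Subgroup G, N.Normal ∧
      (∀ n ∈ N, ∀ m ∈ N, n * m = m * n) ∧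
      (∀ n ∈ N, n ^ 9 = 1) ∧
      ∃ C : Subgroup G, N ⊓ C = ⊥ ∧ N ⊔ C = ⊤ ∧
        IsLocallyCyclic2Group C ∧
        ∀ c ∈ C, c ≠ 1 → ∀ n ∈ N, n ≠ 1 → c * n * c⁻¹ ≠ n := by
  obtain ⟨g0, hg0⟩ := (hG.1.2.1 2 Nat.prime_two).2 (Or.inl rfl)
  obtain ⟨a, ha⟩ : ∃ a : G, IsInv a := by
    obtain ⟨m, hm⟩ := hg0
    have hpos : 0 < orderOf g0 := (hG.1.1 _).orderOf_pos
    refine ⟨g0 ^ m, isInv_of_order ?_⟩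
    rw [orderOf_pow_of_dvd (by omega) (Dvd.intro_left _ hm.symm), hm]
    exact Nat.mul_div_cancel _ (by omega)
  let N : Subgroup G :=
    { carrier := {n | ∃ x y, IsInv x ∧ IsInv y ∧ n = x * y}
      one_mem' := ⟨a, a, ha, ha, ha.2.symm⟩
      mul_mem' := by
        rintro _ _ ⟨x, y, hx, hy, rfl⟩ ⟨z, w, hz, hw, rfl⟩
        exact ⟨x * y * z, w, triple hG hx hy hz, hw, by group⟩
      inv_mem' := by
        rintro _ ⟨x, y, hx, hy, rfl⟩
        exact ⟨y, x, hy, hx, by rw [mul_inv_rev, hx.inv, hy.inv]⟩ }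
  have hN9 : ∀ n ∈ N, n ^ 9 = 1 := by
    rintro _ ⟨x, y, hx, hy, rfl⟩
    exact ab9 hG hx hy
  have hdisj : ∀ n ∈ N, Commute a n → n = 1 := by
    intro n hn hc
    obtain ⟨k, hk⟩ := cen_two hG ha hc
    have h1 := orderOf_dvd_of_pow_eq_one (hN9 n hn)
    have h2 : Nat.Coprime (orderOf n) 9 := by
      rw [hk]; exact Nat.Coprime.pow_left _ (by norm_num)
    exact orderOf_eq_one_iff.1 (Nat.Coprime.eq_one_of_dvd h2 h1)
  refine ⟨N, ⟨?_⟩, ?_, hN9, Subgroup.centralizer {a}, ?_, ?_,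
    hG.2 a ha.1 (by rw [pow_two]; exact ha.2), ?_⟩
  · rintro _ ⟨x, y, hx, hy, rfl⟩ g
    exact ⟨_, _, hx.conj g, hy.conj g, by group⟩
  · rintro _ ⟨x, y, hx, hy, rfl⟩ _ ⟨z, w, hz, hw, rfl⟩
    calc x * y * (z * w) = x * y * z * w := by group
      _ = z * (y * x * w) := by rw [rev hG hx hy hz]; group
      _ = z * w * (x * y) := by rw [rev hG hy hx hw]; group
  · rw [eq_bot_iff]
    rintro n ⟨hn, hc⟩
    have hc' := Subgroup.mem_centralizer_singleton_iff.1 hc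
    exact Subgroup.mem_bot.2 (hdisj n hn hc'.symm)
  · rw [eq_top_iff]
    rintro g -
    obtain ⟨e, he, hc⟩ := mid hG ha g
    have h1 : g * e ∈ Subgroup.centralizer {a} :=
      Subgroup.mem_centralizer_singleton_iff.2 hc.eq.symm
    have h2 : a ∈ Subgroup.centralizer {a} := Subgroup.mem_centralizer_singleton_iff.2 rfl
    have h3 : e * a ∈ N := ⟨e, a, he, ha, rfl⟩
    have h4 : g = g * e * (e * a) * a := by
      have : g * e * (e * a) * a = g * (e * e) * (a * a) := by group
      rw [this, he.2, ha.2, mul_one, mul_one]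
    rw [h4]
    exact mul_mem (mul_mem (Subgroup.mem_sup_right h1) (Subgroup.mem_sup_left h3))
      (Subgroup.mem_sup_right h2)
  · intro c hc hc1 n hn hn1 heq
    have hc' : Commute a c := (Subgroup.mem_centralizer_singleton_iff.1 hc).symm
    obtain ⟨m, hm⟩ := pow_eq_inv hG ha hc' hc1
    have hcn : Commute c n := mul_inv_eq_iff_eq_mul.1 heq
    exact hn1 (hdisj n hn (hm ▸ hcn.pow_left m))
end

section
/- Let G be a group satisfying hypothesis (H*). Then G is locally finite, i.e., every finitely generated subgroup of G is finite. -/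
namespace TC

/-- Letters: `0 = i`, `1 = i⁻¹`, `2 = u`, `3 = u⁻¹`. -/
def linv : ℕ → ℕ
  | 0 => 1
  | 1 => 0
  | 2 => 3
  | _ => 2

def winv (w : List ℕ) : List ℕ := (w.map linv).reverse

/-- Lookup in the table; written with `List.rec` so that the kernel evaluates it fast. -/
noncomputable def look (F : List (ℕ × ℕ × ℕ)) (c l : ℕ) : Option ℕ :=
  List.rec none (fun f _ ih => cond (Nat.beq f.1 c) (cond (Nat.beq f.2.1 l) (some f.2.2) ih) ih) F

theorem look_cons (f : ℕ × ℕ × ℕ) (F : List (ℕ × ℕ × ℕ)) (c l : ℕ) : look (f :: F) c l =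
    if f.1 = c then (if f.2.1 = l then some f.2.2 else look F c l) else look F c l := by
  have h : look (f :: F) c l =
    cond (Nat.beq f.1 c) (cond (Nat.beq f.2.1 l) (some f.2.2) (look F c l)) (look F c l) := rfl
  rw [h, Bool.cond_eq_ite, Bool.cond_eq_ite]
  simp only [Nat.beq_eq]

noncomputable def walk (F : List (ℕ × ℕ × ℕ)) : ℕ → List ℕ → Option ℕ
  | s, [] => some s
  | s, l :: w => match look F s l with
    | none => none
    | some t => walk F t w

/-- The relators `i^4`, `u^3`, `(i^2 u)^2`, `(i u)^9`, `(i⁻¹ u i u⁻¹)^9`. -/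
def rels : List (List ℕ) :=
  [[0, 0, 0, 0], [2, 2, 2], [0, 0, 2, 0, 0, 2],
   (List.replicate 9 [0, 2]).flatten, (List.replicate 9 [1, 2, 0, 3]).flatten]

def getWord (subs : List (List ℕ)) (x s : ℕ) : Option (List ℕ) :=
  if x < 5 then some (rels.getD x [])
  else if s = 0 then some (subs.getD (x - 5) []) else none

noncomputable def runSteps (subs : List (List ℕ)) : ℕ → List (ℕ × ℕ × ℕ) → List (ℕ × ℕ × ℕ) →
    Option (List (ℕ × ℕ × ℕ))
  | _, F, [] => some F
  | n, F, (0, c, l) :: r =>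
    if c < n then
      runSteps subs (n + 1) ((c, l, n) :: (n, linv l, c) :: F) r
    else none
  | n, F, (x + 1, p, s) :: r =>
    match getWord subs x s with
    | none => none
    | some w =>
      match w.drop p with
      | [] => none
      | l :: y =>
        match walk F s (w.take p), walk F s (winv y) with
        | some f, some b => runSteps subs n ((f, l, b) :: (b, linv l, f) :: F) r
        | _, _ => none

def mkWords : List (List ℕ) → List (ℕ × ℕ × ℕ) → List (List ℕ)
  | W, [] => W
  | W, (0, c, l) :: r => mkWords (W ++ [W.getD c [] ++ [l]]) r
  | W, (_ + 1, _, _) :: r => mkWords W r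

/-- Run one stage; returns a new word lying in the subgroup. -/
noncomputable def runStage (subs W : List (List ℕ)) (st : List (ℕ × ℕ × ℕ)) (fin : ℕ × ℕ × ℕ) :
    Option (List ℕ) :=
  match runSteps subs 1 [] st with
  | none => none
  | some F =>
    match getWord subs (fin.1 - 1) fin.2.2 with
    | none => none
    | some w =>
      match walk F fin.2.2 (w.take fin.2.1), walk F fin.2.2 (winv (w.drop fin.2.1)) with
      | some f, some b => some (W.getD f [] ++ winv (W.getD b []))
      | _, _ => none

noncomputable def runAll : List (List ℕ) → List (List (ℕ × ℕ × ℕ) × (ℕ × ℕ × ℕ)) → Option (List (List ℕ))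
  | subs, [] => some subs
  | subs, (st, fin) :: r =>
    match runStage subs (mkWords [[]] st) st fin with
    | none => none
    | some w => runAll (subs ++ [w]) r

def cert : List (List (ℕ × ℕ × ℕ) × (ℕ × ℕ × ℕ)) :=
  [([(0, 0, 0), (6, 1, 0), (0, 0, 1), (0, 0, 2), (2, 0, 3), (0, 1, 0), (1, 0, 4), (3, 2, 0), (0,
    2, 2), (2, 0, 5), (0, 3, 0), (3, 1, 3), (0, 3, 1), (1, 0, 5), (0, 6, 3), (0, 6, 2), (2, 0, 9),
    (0, 7, 3), (0, 7, 2), (2, 0, 11), (0, 8, 0), (0, 8, 1), (3, 0, 11), (1, 0, 12), (0, 9, 0), (3,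
    1, 9), (0, 9, 1), (1, 0, 10), (0, 12, 3), (0, 12, 2), (0, 13, 3), (0, 13, 2), (2, 0, 19), (0,
    14, 3), (0, 14, 2), (2, 0, 21), (0, 15, 3), (0, 15, 2), (0, 16, 0), (0, 16, 1), (3, 0, 19),
    (1, 0, 24), (0, 17, 0), (3, 1, 17), (0, 17, 1), (1, 0, 18), (0, 20, 0), (0, 20, 1), (3, 0,
    23), (0, 21, 0), (3, 1, 21), (0, 21, 1), (0, 24, 3), (0, 24, 2), (2, 0, 33), (0, 25, 3), (0,
    25, 2), (0, 26, 3), (0, 26, 2), (2, 0, 37), (0, 27, 2), (0, 28, 3), (0, 28, 2), (2, 0, 40),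
    (0, 29, 3), (0, 29, 2), (2, 0, 42), (0, 30, 3), (0, 30, 2), (2, 0, 44), (4, 0, 44), (3, 0,
    40), (0, 31, 3), (3, 1, 44), (1, 0, 45), (0, 32, 0), (0, 32, 1), (3, 0, 35), (1, 0, 46), (0,
    33, 0), (3, 1, 33), (0, 33, 1), (1, 0, 34), (0, 36, 0), (0, 36, 1), (3, 0, 38), (4, 1, 35),
    (3, 2, 51), (0, 37, 0), (0, 39, 0), (3, 1, 39), (0, 39, 1), (1, 0, 42), (0, 43, 0), (0, 43,
    1), (0, 46, 2), (2, 0, 57), (0, 47, 3), (2, 0, 51), (0, 48, 3), (0, 49, 2), (0, 52, 2), (0,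
    53, 3), (0, 54, 2), (0, 55, 2), (0, 56, 3), (0, 57, 0), (3, 1, 57), (0, 57, 1), (1, 0, 58),
    (0, 59, 1), (3, 0, 60), (0, 61, 0), (0, 61, 1), (0, 62, 0), (0, 62, 1), (3, 0, 63), (0, 64,
    0), (3, 1, 64), (0, 64, 1), (0, 66, 3), (0, 67, 2), (0, 68, 3), (0, 69, 2), (0, 70, 3), (0,
    71, 2), (0, 72, 3), (0, 72, 2), (2, 0, 82), (4, 0, 82), (0, 73, 3), (4, 0, 78), (3, 1, 78),
    (0, 73, 2), (2, 0, 84), (4, 0, 84), (3, 0, 80), (0, 74, 3), (3, 1, 84), (1, 0, 85), (0, 74,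
    2), (2, 0, 86), (3, 1, 83), (0, 75, 0), (0, 75, 1), (3, 0, 76), (1, 0, 87), (0, 87, 3), (0,
    87, 2), (2, 0, 90), (0, 88, 3), (0, 88, 2), (2, 0, 92), (4, 0, 92), (3, 1, 92), (3, 0, 90),
    (1, 0, 89)], (5, 0, 90)),
   ([(0, 0, 0), (6, 1, 0), (0, 0, 2), (0, 2, 0), (0, 3, 3), (0, 4, 0), (0, 5, 3), (0, 6, 0), (0,
    7, 3), (0, 8, 0), (0, 9, 2), (0, 10, 0), (0, 11, 3), (0, 12, 0), (0, 13, 2), (0, 14, 2), (7,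
    14, 0), (2, 0, 2), (2, 0, 15), (0, 0, 1), (0, 1, 0), (1, 0, 17), (0, 2, 1), (0, 3, 0), (1, 0,
    19), (3, 2, 2), (3, 2, 1), (0, 4, 1), (0, 5, 0), (1, 0, 21), (3, 2, 3), (0, 5, 2), (0, 6, 1),
    (0, 7, 0), (1, 0, 24), (3, 2, 5), (0, 8, 1), (0, 9, 0), (1, 0, 26), (3, 2, 7), (0, 9, 3), (2,
    0, 10), (0, 10, 1), (0, 11, 0), (1, 0, 29), (3, 2, 10), (0, 13, 0), (1, 0, 30), (3, 2, 11),
    (0, 20, 3), (2, 0, 24), (0, 22, 0), (3, 1, 22), (0, 22, 1), (1, 0, 31), (0, 25, 2), (2, 0,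
    34), (0, 27, 0), (3, 1, 27), (0, 27, 1), (1, 0, 34), (4, 1, 34), (3, 2, 32)], (4, 1, 13)),
   ([(0, 0, 2), (0, 1, 0), (0, 2, 3), (0, 3, 0), (0, 4, 3), (0, 5, 0), (0, 6, 3), (0, 7, 0), (0,
    8, 2), (0, 9, 0), (0, 10, 3), (0, 11, 0), (0, 12, 0), (8, 13, 0), (0, 13, 2), (7, 14, 0)], (3,
    0, 13)),
   ([(0, 0, 2), (0, 1, 0), (0, 2, 3), (0, 3, 0), (0, 4, 3), (0, 5, 0), (0, 6, 3), (0, 7, 0), (0,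
    8, 2), (0, 9, 0), (0, 10, 3), (0, 11, 0), (9, 12, 0), (8, 13, 0)], (7, 14, 0)),
   ([(0, 0, 2), (0, 1, 0), (0, 2, 3), (0, 3, 0), (0, 4, 3), (0, 5, 0), (0, 6, 3), (0, 7, 0), (0,
    8, 2), (0, 9, 0), (10, 11, 0), (9, 12, 0)], (8, 17, 0)),
   ([(0, 0, 2), (0, 1, 0), (0, 2, 3), (0, 3, 0), (0, 4, 3), (0, 5, 3), (0, 6, 1), (0, 7, 2), (11,
    8, 0)], (10, 13, 0)),
   ([(0, 0, 2), (0, 1, 0), (0, 2, 3)], (12, 5, 0)),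
   ([(0, 0, 2), (0, 1, 2), (13, 2, 0)], (11, 6, 0)),
   ([(0, 0, 3), (14, 1, 0)], (2, 0, 0))]

section sound
variable {G : Type*} [Group G] (i u : G)

def ltr : ℕ → G
  | 0 => i
  | 1 => i⁻¹
  | 2 => u
  | _ => u⁻¹

def ev (w : List ℕ) : G := (w.map (ltr i u)).prod

theorem ltr_linv (l : ℕ) : ltr i u (linv l) = (ltr i u l)⁻¹ := by
  match l with
  | 0 => rfl
  | 1 => simp [ltr, linv]
  | 2 => rfl
  | n + 3 => simp [ltr, linv]

theorem ev_append (a b : List ℕ) : ev i u (a ++ b) = ev i u a * ev i u b := by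
  simp [ev]

theorem ev_cons (l : ℕ) (b : List ℕ) : ev i u (l :: b) = ltr i u l * ev i u b := by
  simp [ev]

theorem ev_nil : ev i u [] = 1 := by simp [ev]

theorem ev_winv (a : List ℕ) : ev i u (winv a) = (ev i u a)⁻¹ := by
  induction a with
  | nil => simp [ev, winv]
  | cons l a ih =>
    have : winv (l :: a) = winv a ++ [linv l] := by simp [winv]
    rw [this, ev_append, ih, ev_cons, ev_cons, ev_nil, ltr_linv]
    group

variable (H : Subgroup G)

def Good (r : ℕ → G) (F : List (ℕ × ℕ × ℕ)) : Prop :=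
  ∀ f ∈ F, r f.1 * ltr i u f.2.1 * (r f.2.2)⁻¹ ∈ H

theorem look_sound {r : ℕ → G} {F : List (ℕ × ℕ × ℕ)} (hF : Good i u H r F) (c l t : ℕ)
    (h : look F c l = some t) : r c * ltr i u l * (r t)⁻¹ ∈ H := by
  induction F with
  | nil => simp [look] at h
  | cons f F ih =>
    have h1 := hF f (by simp)
    have ih' := ih (fun g hg => hF g (by simp [hg]))
    rw [look_cons] at h
    split_ifs at h with h2 h3
    · simp only [Option.some.injEq] at h
      subst h2 h3 h
      exact h1
    · exact ih' h
    · exact ih' h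

theorem walk_sound {r : ℕ → G} {F : List (ℕ × ℕ × ℕ)} (hF : Good i u H r F) (w : List ℕ) :
    ∀ s t : ℕ, walk F s w = some t → r s * ev i u w * (r t)⁻¹ ∈ H := by
  induction w with
  | nil =>
    intro s t h
    simp only [walk, Option.some.injEq] at h
    subst h
    simp [ev]
  | cons l w ih =>
    intro s t h
    simp only [walk] at h
    split at h
    · simp at h
    · rename_i x hx
      have h1 := look_sound i u H hF s l x hx
      have h2 := ih x t h
      have := H.mul_mem h1 h2
      rw [ev_cons]
      convert this using 1
      group

theorem mkWords_prefix (st : List (ℕ × ℕ × ℕ)) : ∀ (W : List (List ℕ)) (k : ℕ), k < W.length →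
    (mkWords W st).getD k [] = W.getD k [] := by
  induction st with
  | nil => intro W k _; rfl
  | cons a st ih =>
    intro W k hk
    obtain ⟨x, p, q⟩ := a
    cases x with
    | zero =>
      rw [mkWords, ih _ k (by simp; omega), List.getD_append _ _ _ _ hk]
    | succ x => rw [mkWords, ih _ k hk]

theorem getWord_sound (hrel : ∀ x, ev i u (rels.getD x []) = 1)
    {subs W : List (List ℕ)} (hs : ∀ x, ev i u (subs.getD x []) ∈ H)
    (hW : W.getD 0 [] = []) {x s : ℕ} {w : List ℕ} (h : getWord subs x s = some w) :
    ev i u (W.getD s []) * ev i u w * (ev i u (W.getD s []))⁻¹ ∈ H := by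
  unfold getWord at h
  split_ifs at h with h1 h2
  · simp only [Option.some.injEq] at h
    rw [← h, hrel]
    simp
  · simp only [Option.some.injEq] at h
    rw [← h, h2, hW, ev_nil]
    simpa using hs (x - 5)

theorem runSteps_sound (hrel : ∀ x, ev i u (rels.getD x []) = 1)
    {subs W : List (List ℕ)} (hs : ∀ x, ev i u (subs.getD x []) ∈ H)
    (hW : W.getD 0 [] = []) (st : List (ℕ × ℕ × ℕ)) :
    ∀ (n : ℕ) (F F' : List (ℕ × ℕ × ℕ)) (W₀ : List (List ℕ)), W₀.length = n →
    W = mkWords W₀ st →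
    Good i u H (fun n => ev i u (W.getD n [])) F → runSteps subs n F st = some F' →
    Good i u H (fun n => ev i u (W.getD n [])) F' := by
  induction st with
  | nil =>
    intro n F F' W₀ hn hW₀ hF h
    simp only [runSteps, Option.some.injEq] at h
    exact h ▸ hF
  | cons a st ih =>
    intro n F F' W₀ hn hW₀ hF h
    obtain ⟨x, p, s⟩ := a
    -- adding an edge in both directions
    have key : ∀ f l b : ℕ, ev i u (W.getD f []) * ltr i u l * (ev i u (W.getD b []))⁻¹ ∈ H →
        Good i u H (fun n => ev i u (W.getD n [])) ((f, l, b) :: (b, linv l, f) :: F) := by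
      intro f l b h g hg
      simp only [List.mem_cons] at hg
      rcases hg with rfl | rfl | hg
      · exact h
      · have := H.inv_mem h
        simp only [ltr_linv]
        convert this using 1
        group
      · exact hF g hg
    cases x with
    | zero =>
      simp only [runSteps] at h
      split_ifs at h with h1
      rw [mkWords] at hW₀
      refine ih _ _ _ _ (by simp [hn]) hW₀ (key _ _ _ ?_) h
      have h2 : W.getD n [] = W₀.getD p [] ++ [s] := by
        rw [hW₀, mkWords_prefix _ _ _ (by simp; omega),
          List.getD_append_right _ _ _ _ (by omega), hn]
        simp
      have h3 : W.getD p [] = W₀.getD p [] := by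
        rw [hW₀, mkWords_prefix _ _ _ (by simp; omega), List.getD_append _ _ _ _ (by omega)]
      rw [h2, h3, ev_append, ev_cons, ev_nil]
      convert H.one_mem using 1
      group
    | succ x =>
      simp only [runSteps] at h
      split at h
      · simp at h
      rename_i w hw
      split at h
      · simp at h
      rename_i l y hy
      split at h
      · rename_i f b hf hb
        refine ih _ _ _ W₀ hn hW₀ (key _ _ _ ?_) h
        have h1 := walk_sound i u H hF _ _ _ hf
        have h2 := walk_sound i u H hF _ _ _ hb
        have h3 := getWord_sound i u H hrel hs hW hw
        have h4 : w = w.take p ++ (l :: y) := by rw [← hy, List.take_append_drop]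
        rw [h4, ev_append, ev_cons] at h3
        rw [ev_winv] at h2
        convert H.mul_mem (H.mul_mem (H.inv_mem h1) h3) h2 using 1
        group
      · simp at h

theorem runStage_sound (hrel : ∀ x, ev i u (rels.getD x []) = 1)
    {subs W : List (List ℕ)} (hs : ∀ x, ev i u (subs.getD x []) ∈ H)
    {st : List (ℕ × ℕ × ℕ)} {fin : ℕ × ℕ × ℕ} {v : List ℕ}
    (hW₀ : W = mkWords [[]] st)
    (h : runStage subs W st fin = some v) : ev i u v ∈ H := by
  have hW : W.getD 0 [] = [] := by rw [hW₀, mkWords_prefix _ _ _ (by simp)]; rfl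
  unfold runStage at h
  split at h
  · simp at h
  rename_i F hF
  have hG := runSteps_sound i u H hrel hs hW st 1 [] F [[]] rfl hW₀ (by intro f hf; simp at hf) hF
  split at h
  · simp at h
  rename_i w hw
  split at h
  · rename_i f b hf hb
    have h1 := walk_sound i u H hG _ _ _ hf
    have h2 := walk_sound i u H hG _ _ _ hb
    have h3 := getWord_sound i u H hrel hs hW hw
    simp only [Option.some.injEq] at h
    have h4 : w = w.take fin.2.1 ++ w.drop fin.2.1 := by rw [List.take_append_drop]
    rw [h4, ev_append] at h3
    rw [ev_winv] at h2
    rw [← h, ev_append, ev_winv]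
    convert H.mul_mem (H.mul_mem (H.inv_mem h1) h3) h2 using 1
    group
  · simp at h

theorem runAll_sound (hrel : ∀ x, ev i u (rels.getD x []) = 1)
    (c : List (List (ℕ × ℕ × ℕ) × (ℕ × ℕ × ℕ))) :
    ∀ (subs subs' : List (List ℕ)), (∀ x, ev i u (subs.getD x []) ∈ H) →
    runAll subs c = some subs' → ∀ x, ev i u (subs'.getD x []) ∈ H := by
  induction c with
  | nil =>
    intro subs subs' hs h
    simp only [runAll, Option.some.injEq] at h
    exact h ▸ hs
  | cons a c ih =>
    intro subs subs' hs h
    obtain ⟨st, fin⟩ := a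
    simp only [runAll] at h
    split at h
    · simp at h
    rename_i w hw
    refine ih _ _ ?_ h
    have h1 := runStage_sound i u H hrel hs rfl hw
    intro x
    rcases lt_trichotomy x subs.length with hx | hx | hx
    · rw [List.getD_append _ _ _ _ hx]; exact hs x
    · subst hx
      simpa using h1
    · rw [List.getD_eq_default _ _ (by simp; omega)]
      simp [ev]

end sound

theorem cert_ok : (runAll [[0, 2]] cert).map (fun s => s.getD 9 []) = some [2] := by
  decide +kernel

/-- The coset enumeration: the relations force `u ∈ ⟨i u⟩`. -/
theorem mem_zpowers {G : Type*} [Group G] (i u : G) (h1 : i ^ 4 = 1) (h2 : u ^ 3 = 1)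
    (h3 : (i ^ 2 * u) ^ 2 = 1) (h4 : (i * u) ^ 9 = 1) (h5 : (i⁻¹ * u * i * u⁻¹) ^ 9 = 1) :
    u ∈ Subgroup.zpowers (i * u) := by
  have hrel : ∀ x, ev i u (rels.getD x []) = 1 := by
    intro x
    match x with
    | 0 => simpa [rels, ev, ltr, pow_succ, mul_assoc] using h1
    | 1 => simpa [rels, ev, ltr, pow_succ, mul_assoc] using h2
    | 2 => simpa [rels, ev, ltr, pow_succ, mul_assoc] using h3
    | 3 => simpa [rels, ev, ltr, pow_succ, mul_assoc, List.replicate] using h4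
    | 4 => simpa [rels, ev, ltr, pow_succ, mul_assoc, List.replicate] using h5
    | n + 5 => simp [rels, ev]
  obtain ⟨s, hs, hs'⟩ := Option.map_eq_some_iff.1 cert_ok
  have := runAll_sound i u (Subgroup.zpowers (i * u)) hrel cert [[0, 2]] s ?_ hs 9
  · rw [hs'] at this
    simpa [ev, ltr] using this
  · intro x
    match x with
    | 0 => simp [ev, ltr]
    | n + 1 => simp [ev]

end TC

section HStar
variable {G : Type*} [Group G]

/-- involution -/
def Inv2 (a : G) : Prop := a ≠ 1 ∧ a ^ 2 = 1

theorem Inv2.mul_self {a : G} (h : Inv2 a) : a * a = 1 := by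
  have := h.2; rwa [pow_two] at this

theorem Inv2.inv_eq {a : G} (h : Inv2 a) : a⁻¹ = a :=
  inv_eq_of_mul_eq_one_left h.mul_self

theorem Inv2.conj {a : G} (h : Inv2 a) (g : G) : Inv2 (g⁻¹ * a * g) := by
  refine ⟨fun h1 => h.1 ?_, ?_⟩
  · have : a = g * (g⁻¹ * a * g) * g⁻¹ := by group
    rw [this, h1]; group
  · have : (g⁻¹ * a * g) ^ 2 = g⁻¹ * (a * a) * g := by rw [pow_two]; group
    rw [this, h.mul_self]; group

theorem Inv2.orderOf {a : G} (h : Inv2 a) : orderOf a = 2 :=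
  orderOf_eq_prime h.2 h.1

theorem comm_centralizer (hG : HypHStar G) {a c d : G} (ha : Inv2 a) (hc : Commute c a)
    (hd : Commute d a) : Commute c d := by
  have hC := (hG.2 a ha.1 ha.2).2
  let c' : Subgroup.centralizer ({a} : Set G) := ⟨c, by
    rw [Subgroup.mem_centralizer_singleton_iff]; exact hc⟩
  let d' : Subgroup.centralizer ({a} : Set G) := ⟨d, by
    rw [Subgroup.mem_centralizer_singleton_iff]; exact hd⟩
  have hcyc := hC (Subgroup.closure {c', d'}) ((Subgroup.fg_iff _).2 ⟨{c', d'}, rfl, by simp⟩)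
  have h1 : c' ∈ Subgroup.closure {c', d'} := Subgroup.subset_closure (by simp)
  have h2 : d' ∈ Subgroup.closure {c', d'} := Subgroup.subset_closure (by simp)
  have h3 := (IsCyclic.commGroup (α := Subgroup.closure {c', d'})).mul_comm ⟨c', h1⟩ ⟨d', h2⟩
  have h4 := congrArg (fun x : Subgroup.closure {c', d'} => (x.1.1 : G)) h3
  exact h4

theorem two_pow_centralizer (hG : HypHStar G) {a c : G} (ha : Inv2 a) (hc : Commute c a) :
    ∃ n, _root_.orderOf c = 2 ^ n := by
  have hC := (hG.2 a ha.1 ha.2).1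
  obtain ⟨n, hn⟩ := hC ⟨c, by rw [Subgroup.mem_centralizer_singleton_iff]; exact hc⟩
  exact ⟨n, by rwa [Subgroup.orderOf_mk] at hn⟩

theorem invol_unique (hG : HypHStar G) {a b : G} (ha : Inv2 a) (hb : Inv2 b)
    (hab : Commute b a) : b = a := by
  have hC := (hG.2 a ha.1 ha.2).2
  let c' : Subgroup.centralizer ({a} : Set G) := ⟨a, by
    rw [Subgroup.mem_centralizer_singleton_iff]⟩
  let d' : Subgroup.centralizer ({a} : Set G) := ⟨b, by
    rw [Subgroup.mem_centralizer_singleton_iff]; exact hab⟩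
  have hcyc := hC (Subgroup.closure {c', d'}) ((Subgroup.fg_iff _).2 ⟨{c', d'}, rfl, by simp⟩)
  have h1 : c' ∈ Subgroup.closure {c', d'} := Subgroup.subset_closure (by simp)
  have h2 : d' ∈ Subgroup.closure {c', d'} := Subgroup.subset_closure (by simp)
  obtain ⟨g, hg⟩ := hcyc.exists_generator
  obtain ⟨m, hm⟩ := Subgroup.mem_zpowers_iff.1 (hg ⟨c', h1⟩)
  obtain ⟨n, hn⟩ := Subgroup.mem_zpowers_iff.1 (hg ⟨d', h2⟩)
  have hm' : ((g : Subgroup.centralizer ({a} : Set G)) : G) ^ m = a := by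
    have := congrArg (fun x : Subgroup.closure {c', d'} => (x.1.1 : G)) hm
    simpa using this
  have hn' : ((g : Subgroup.centralizer ({a} : Set G)) : G) ^ n = b := by
    have := congrArg (fun x : Subgroup.closure {c', d'} => (x.1.1 : G)) hn
    simpa using this
  generalize ((g : Subgroup.centralizer ({a} : Set G)) : G) = z at hm' hn'
  have hz : IsOfFinOrder z := hG.1.1 z
  have hpos := hz.orderOf_pos
  have a1 : (_root_.orderOf z : ℤ) ∣ m * 2 := by
    rw [orderOf_dvd_iff_zpow_eq_one, zpow_mul, hm']
    exact_mod_cast ha.2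
  have b1 : (_root_.orderOf z : ℤ) ∣ n * 2 := by
    rw [orderOf_dvd_iff_zpow_eq_one, zpow_mul, hn']
    exact_mod_cast hb.2
  have a2 : ¬ (_root_.orderOf z : ℤ) ∣ m := by
    rw [orderOf_dvd_iff_zpow_eq_one, hm']; exact ha.1
  have b2 : ¬ (_root_.orderOf z : ℤ) ∣ n := by
    rw [orderOf_dvd_iff_zpow_eq_one, hn']; exact hb.1
  have key : (_root_.orderOf z : ℤ) ∣ n - m := by
    obtain ⟨s, hs⟩ := a1
    obtain ⟨t, ht⟩ := b1
    have hs' : Odd s := by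
      rw [← Int.not_even_iff_odd]
      rintro ⟨k, rfl⟩
      exact a2 ⟨k, by linarith⟩
    have ht' : Odd t := by
      rw [← Int.not_even_iff_odd]
      rintro ⟨k, rfl⟩
      exact b2 ⟨k, by linarith⟩
    obtain ⟨k, rfl⟩ := hs'
    obtain ⟨l, rfl⟩ := ht'
    exact ⟨l - k, by linarith⟩
  rw [orderOf_dvd_iff_zpow_eq_one, zpow_sub, hn', hm', mul_inv_eq_one] at key
  exact key

/-- A nontrivial element of 2-power order has a power that is an involution. -/
theorem exists_inv_pow {c : G} {n : ℕ} (h : c ^ (2 ^ n) = 1) (hc : c ≠ 1) :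
    ∃ k, Inv2 (c ^ (2 ^ k)) := by
  induction n with
  | zero => simp at h; exact absurd h hc
  | succ n ih =>
    by_cases h1 : c ^ (2 ^ n) = 1
    · exact ih h1
    · exact ⟨n, h1, by rw [← pow_mul, ← pow_succ]; exact h⟩

/-- an element commuting with an involution and having 3-power order is trivial -/
theorem eq_one_of_commute (hG : HypHStar G) {a c : G} (ha : Inv2 a) (hc : Commute c a)
    (h : c ^ 9 = 1) : c = 1 := by
  obtain ⟨n, hn⟩ := two_pow_centralizer hG ha hc
  have h1 : _root_.orderOf c ∣ 9 := orderOf_dvd_of_pow_eq_one h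
  have h2 : Nat.Coprime (2 ^ n) 9 := Nat.Coprime.pow_left _ (by norm_num)
  rw [hn] at h1
  have := Nat.eq_one_of_dvd_coprimes h2 dvd_rfl h1
  rw [← hn] at this
  exact orderOf_eq_one_iff.1 this

theorem prod_order (hG : HypHStar G) {x y : G} (hx : orderOf x ≤ 4) (hy : orderOf y ≤ 4) :
    (x * y) ^ 8 = 1 ∨ (x * y) ^ 9 = 1 := by
  have h9 := hG.1.2.2 x y hx hy
  have hpos := (hG.1.1 (x * y)).orderOf_pos
  have hp := hG.1.2.1
  generalize hz : x * y = z at *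
  have h5 : ¬ 5 ∣ orderOf z := fun h => by
    have := (hp 5 (by norm_num)).1 ⟨z, h⟩; omega
  have h7 : ¬ 7 ∣ orderOf z := fun h => by
    have := (hp 7 (by norm_num)).1 ⟨z, h⟩; omega
  have h6 : orderOf z ≠ 6 := fun h => by
    have h1 : orderOf (z ^ 3) = 2 := by rw [(hG.1.1 z).orderOf_pow, h]; rfl
    have h2 : orderOf (z ^ 2) = 3 := by rw [(hG.1.1 z).orderOf_pow, h]; rfl
    have hi : Inv2 (z ^ 3) := ⟨fun h0 => by rw [h0] at h1; simp at h1, by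
      rw [← h1]; exact pow_orderOf_eq_one _⟩
    have := eq_one_of_commute hG hi (c := z ^ 2) ((Commute.refl z).pow_pow 2 3) (by
      rw [← pow_mul]; rw [show 2 * 9 = 6 * 3 by norm_num, pow_mul, ← h, pow_orderOf_eq_one, one_pow])
    rw [this] at h2; simp at h2
  have : orderOf z ∣ 8 ∨ orderOf z ∣ 9 := by
    generalize orderOf z = n at *
    interval_cases n <;> simp_all
  rcases this with h | h
  · exact Or.inl (orderOf_dvd_iff_pow_eq_one.1 h)
  · exact Or.inr (orderOf_dvd_iff_pow_eq_one.1 h)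

/-- the product of two involutions has order dividing 9 -/
theorem inv_mul_inv (hG : HypHStar G) {a b : G} (ha : Inv2 a) (hb : Inv2 b) :
    (a * b) ^ 9 = 1 := by
  rcases prod_order hG (x := a) (y := b) (by rw [ha.orderOf]; norm_num)
    (by rw [hb.orderOf]; norm_num) with h | h
  · by_cases h1 : a * b = 1
    · rw [h1, one_pow]
    obtain ⟨k, hk⟩ := exists_inv_pow (n := 3) h h1
    have e1 : a * (a * b) * a⁻¹ = (a * b)⁻¹ := by
      rw [mul_inv_rev, ha.inv_eq, hb.inv_eq, ← mul_assoc, ha.mul_self, one_mul]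
    have e2 : b * (a * b) * b⁻¹ = (a * b)⁻¹ := by
      rw [mul_inv_rev, ha.inv_eq, hb.inv_eq, mul_assoc, mul_assoc, hb.mul_self, mul_one]
    have f : ∀ c, c * (a * b) * c⁻¹ = (a * b)⁻¹ → Commute ((a * b) ^ (2 ^ k)) c := by
      intro c hc
      have : c * (a * b) ^ (2 ^ k) * c⁻¹ = (a * b) ^ (2 ^ k) := by
        rw [← conj_pow, hc, inv_pow, hk.inv_eq]
      exact (mul_inv_eq_iff_eq_mul.1 this).symm
    have g1 := invol_unique hG ha hk (f a e1)
    have g2 := invol_unique hG hb hk (f b e2)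
    rw [g1] at g2
    exact absurd (by rw [g2, hb.mul_self]) h1
  · exact h

/-- `u` is inverted by `a` and has order dividing 9 -/
def NegBy (a u : G) : Prop := a * u * a = u⁻¹ ∧ u ^ 9 = 1

theorem NegBy.inv2 {a u : G} (ha : Inv2 a) (h : NegBy a u) : Inv2 (a * u) := by
  refine ⟨fun h1 => ?_, ?_⟩
  · have h2 : u = a := by
      have := eq_inv_of_mul_eq_one_right h1
      rwa [ha.inv_eq] at this
    have h3 := h.2
    rw [h2, show 9 = 2 * 4 + 1 by norm_num, pow_succ, pow_mul, ha.2, one_pow, one_mul] at h3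
    exact ha.1 h3
  · rw [pow_two, ← mul_assoc, h.1, inv_mul_cancel]

theorem NegBy.inv2' {a u : G} (ha : Inv2 a) (h : NegBy a u) : Inv2 (u * a) := by
  have := (h.inv2 ha).conj a
  convert this using 1
  rw [ha.inv_eq, ← mul_assoc, ha.mul_self, one_mul]

theorem negBy_mul (hG : HypHStar G) {a b : G} (ha : Inv2 a) (hb : Inv2 b) : NegBy a (a * b) := by
  refine ⟨?_, inv_mul_inv hG ha hb⟩
  rw [mul_inv_rev, ha.inv_eq, hb.inv_eq, ← mul_assoc, ha.mul_self, one_mul]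

theorem NegBy.inv {a u : G} (ha : Inv2 a) (h : NegBy a u) : NegBy a u⁻¹ := by
  refine ⟨?_, by rw [inv_pow, h.2, inv_one]⟩
  rw [← h.1]
  have : a * (a * u * a) * a = (a * a) * u * (a * a) := by group
  rw [this, ha.mul_self, h.1, inv_inv]; group

theorem NegBy.pow {a u : G} (ha : Inv2 a) (h : NegBy a u) (n : ℕ) : NegBy a (u ^ n) := by
  refine ⟨?_, by rw [← pow_mul, mul_comm, pow_mul, h.2, one_pow]⟩
  have h1 : a * u * a⁻¹ = u⁻¹ := by rw [ha.inv_eq, h.1]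
  have : a * u ^ n * a⁻¹ = (u⁻¹) ^ n := by rw [← h1, conj_pow]
  rw [ha.inv_eq] at this
  rw [this, inv_pow]

/-- conjugation by an element of the centralizer -/
theorem NegBy.conj {a u c : G} (h : NegBy a u) (hc : Commute c a) : NegBy a (c⁻¹ * u * c) := by
  have hc' : Commute c⁻¹ a := hc.inv_left
  refine ⟨?_, ?_⟩
  · have : a * (c⁻¹ * u * c) * a = c⁻¹ * (a * u * a) * c := by
      calc a * (c⁻¹ * u * c) * a = (a * c⁻¹) * u * (c * a) := by group
        _ = (c⁻¹ * a) * u * (a * c) := by rw [hc.eq, hc'.eq]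
        _ = _ := by group
    rw [this, h.1]; group
  · have := conj_pow (a := c⁻¹) (b := u) (i := 9)
    rw [inv_inv] at this
    rw [this, h.2]; group

/-- decomposition -/
theorem decomp (hG : HypHStar G) {a : G} (ha : Inv2 a) (g : G) :
    ∃ c u, Commute c a ∧ NegBy a u ∧ g = c * u ∧ u = (a * (g⁻¹ * a * g)) ^ 5 := by
  have hb := ha.conj g
  have hn := negBy_mul hG ha hb
  set x := a * (g⁻¹ * a * g) with hx
  have hu := hn.pow ha 5
  refine ⟨g * (x ^ 5)⁻¹, x ^ 5, ?_, hu, by group, rfl⟩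
  have e1 : x ^ 5 * x ^ 5 = x := by
    rw [← pow_add, show 5 + 5 = 9 + 1 by norm_num, pow_succ, hn.2, one_mul]
  -- a * u * a = u⁻¹
  have e2 := hu.1
  have e3 : (x ^ 5)⁻¹ * a = a * x ^ 5 := by
    rw [← e2, mul_assoc, ha.mul_self, mul_one]
  change g * (x ^ 5)⁻¹ * a = a * (g * (x ^ 5)⁻¹)
  have e4 : a * x = g⁻¹ * a * g := by rw [hx, ← mul_assoc, ha.mul_self, one_mul]
  calc g * (x ^ 5)⁻¹ * a = g * (a * (x ^ 5 * x ^ 5)) * (x ^ 5)⁻¹ := by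
        rw [mul_assoc, e3]; group
    _ = _ := by rw [e1, e4]; group

/-- a nontrivial element commuting with an involution has an involutory power, equal to it -/
theorem pow_eq_of_commute (hG : HypHStar G) {a c : G} (ha : Inv2 a) (hc : Commute c a)
    (h1 : c ≠ 1) : ∃ k, c ^ (2 ^ k) = a := by
  obtain ⟨n, hn⟩ := two_pow_centralizer hG ha hc
  obtain ⟨k, hk⟩ := exists_inv_pow (n := n) (by rw [← hn, pow_orderOf_eq_one]) h1
  exact ⟨k, invol_unique hG ha hk (hc.pow_left _)⟩

theorem neg_of_commute (hG : HypHStar G) {a w g : G} (ha : Inv2 a) (hw : NegBy a w) (hw1 : w ≠ 1)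
    (hg : Commute g w) : NegBy a g := by
  obtain ⟨c, u, hc, hu, hgcu, hu'⟩ := decomp hG ha g
  have h1 : Commute u w := by
    rw [hu']
    apply Commute.pow_left
    have e : a * w = w⁻¹ * a := by
      rw [← hw.1, mul_assoc, ha.mul_self, mul_one]
    have e' : a * w⁻¹ = w * a := by
      have := (hw.inv ha).1
      rw [inv_inv] at this
      conv_rhs => rw [← this, mul_assoc, ha.mul_self, mul_one]
    change a * (g⁻¹ * a * g) * w = w * (a * (g⁻¹ * a * g))
    calc a * (g⁻¹ * a * g) * w = a * g⁻¹ * a * (g * w) := by group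
      _ = a * g⁻¹ * (a * w) * g := by rw [hg.eq]; group
      _ = a * (g⁻¹ * w⁻¹) * a * g := by rw [e]; group
      _ = (a * w⁻¹) * g⁻¹ * a * g := by rw [(hg.inv_inv).eq]; group
      _ = _ := by rw [e']; group
  have h2 : Commute c w := by
    have : c = g * u⁻¹ := by rw [hgcu]; group
    rw [this]
    exact hg.mul_left h1.inv_left
  by_cases hc1 : c = 1
  · rw [hgcu, hc1, one_mul]; exact hu
  · obtain ⟨k, hk⟩ := pow_eq_of_commute hG ha hc hc1
    have h3 : Commute w a := by rw [← hk]; exact (h2.pow_left _).symm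
    exact absurd (eq_one_of_commute hG ha h3 hw.2) hw1

theorem commute_of_neg {a g h : G} (ha : Inv2 a) (hg : NegBy a g) (hh : NegBy a h)
    (hgh : NegBy a (g * h)) : Commute g h := by
  have e : a * (g * h) * a = (a * g * a) * (a * h * a) := by
    have : (a * g * a) * (a * h * a) = a * g * (a * a) * h * a := by group
    rw [this, ha.mul_self]; group
  rw [hgh.1, hg.1, hh.1, ← mul_inv_rev] at e
  exact (inv_injective e)

theorem commute_trans (hG : HypHStar G) {a w g h : G} (ha : Inv2 a) (hw : NegBy a w) (hw1 : w ≠ 1)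
    (hg : Commute g w) (hh : Commute h w) : Commute g h :=
  commute_of_neg ha (neg_of_commute hG ha hw hw1 hg) (neg_of_commute hG ha hw hw1 hh)
    (neg_of_commute hG ha hw hw1 (hg.mul_left hh))

/-- the key step, order 3 -/
theorem key3 (hG : HypHStar G) {i u : G} (ha : Inv2 (i ^ 2)) (hu : NegBy (i ^ 2) u)
    (h3 : u ^ 3 = 1) : Commute u (i⁻¹ * u * i) := by
  have hi4 : i ^ 4 = 1 := by rw [show 4 = 2 * 2 by norm_num, pow_mul]; exact ha.2
  have hia : Commute i (i ^ 2) := (Commute.refl i).pow_right 2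
  have hv : NegBy (i ^ 2) (i⁻¹ * u * i) := hu.conj hia
  rcases prod_order hG (x := i) (y := u) (orderOf_le_of_pow_eq_one (by norm_num) hi4)
    ((orderOf_le_of_pow_eq_one (by norm_num) h3).trans (by norm_num)) with h8 | h9
  · set v := i⁻¹ * u * i with hvd
    set e := v⁻¹ * u⁻¹ * v * u with he
    have e4 : (i * u) ^ 4 = e := by
      have e1 : (i * u) ^ 2 = i ^ 2 * (v * u) := by rw [hvd, pow_two, pow_two]; group
      have e2 : (i * u) ^ 4 = (i ^ 2 * v * i ^ 2) * ((i ^ 2)⁻¹ * u * (i ^ 2)⁻¹⁻¹) * (v * u) := by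
        rw [show 4 = 2 * 2 by norm_num, pow_mul, e1, pow_two (i ^ 2 * (v * u))]
        group
      rw [inv_inv, ha.inv_eq, hv.1, hu.1] at e2
      rw [e2, he]; group
    have e8 : e ^ 2 = 1 := by rw [← e4, ← pow_mul]; exact h8
    by_cases e1 : e = 1
    · have : v⁻¹ * u⁻¹ * v * u = (u * v)⁻¹ * (v * u) := by group
      rw [he, this, inv_mul_eq_one] at e1
      exact e1
    · have hinv : Inv2 e := ⟨e1, e8⟩
      -- p = e u⁻¹ has order 3
      have hp : (e * u⁻¹) ^ 3 = 1 := by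
        have : e * u⁻¹ = v⁻¹ * u⁻¹ * v⁻¹⁻¹ := by rw [he]; group
        rw [this, conj_pow, inv_pow, h3]; group
      set e2 := u⁻¹ * e * u with he2
      set e3 := (u * u)⁻¹ * e * (u * u) with he3
      have i2 : Inv2 e2 := hinv.conj u
      have i3 : Inv2 e3 := hinv.conj (u * u)
      have hprod : e * e2 * e3 = 1 := by
        have : (e * u⁻¹) ^ 3 = e * e2 * e3 * (u ^ 3)⁻¹ := by
          rw [he2, he3]; simp only [pow_succ, pow_zero, one_mul]; group
        rw [this, h3, inv_one, mul_one] at hp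
        exact hp
      have h12 : e * e2 = e3 := by
        rw [eq_inv_of_mul_eq_one_left hprod, i3.inv_eq]
      have hcomm : Commute e2 e := by
        have h5 := i3.inv_eq
        rw [← h12, mul_inv_rev, hinv.inv_eq, i2.inv_eq] at h5
        exact h5
      have h6 := invol_unique hG hinv i2 hcomm
      have h7 : Commute u e := by
        rw [he2] at h6
        change u * e = e * u
        nth_rewrite 1 [← h6]
        group
      have h10 : u = 1 := eq_one_of_commute hG hinv h7 hu.2
      rw [h10]; exact Commute.one_left _
  · have hmem := TC.mem_zpowers i u hi4 h3 (hu.inv2 ha).2 h9 (by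
      have h1 := inv_mul_inv hG (hv.inv2' ha) ((hu.inv ha).inv2 ha)
      have : (i⁻¹ * u * i) * i ^ 2 * (i ^ 2 * u⁻¹) = i⁻¹ * u * i * (i ^ 2 * i ^ 2) * u⁻¹ := by group
      rw [this, ha.mul_self, mul_one] at h1
      exact h1)
    obtain ⟨n, hn⟩ := Subgroup.mem_zpowers_iff.1 hmem
    have h1 : Commute u (i * u) := by
      nth_rewrite 1 [← hn]
      exact (Commute.refl (i * u)).zpow_left n
    have h2 : Commute u i := by
      have := h1.mul_right (Commute.refl u).inv_right
      rwa [mul_inv_cancel_right] at this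
    have : i⁻¹ * u * i = u := by rw [mul_assoc, h2.eq]; group
    rw [this]

theorem key9 (hG : HypHStar G) {i u : G} (ha : Inv2 (i ^ 2)) (hu : NegBy (i ^ 2) u) :
    Commute u (i⁻¹ * u * i) := by
  by_cases hw1 : u ^ 3 = 1
  · exact key3 hG ha hu hw1
  have hw := hu.pow ha 3
  have hia : Commute i (i ^ 2) := (Commute.refl i).pow_right 2
  have h1 := key3 hG ha hw (by rw [← pow_mul]; exact hu.2)
  have hw' := hw.conj hia
  have hw1' : i⁻¹ * u ^ 3 * i ≠ 1 := by
    intro h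
    apply hw1
    have : u ^ 3 = i * (i⁻¹ * u ^ 3 * i) * i⁻¹ := by group
    rw [this, h]; group
  have h2 : Commute (i⁻¹ * u * i) (i⁻¹ * u ^ 3 * i) := by
    have : i⁻¹ * u ^ 3 * i = (i⁻¹ * u * i) ^ 3 := by
      have := conj_pow (a := i⁻¹) (b := u) (i := 3)
      rw [inv_inv] at this; exact this.symm
    rw [this]
    exact (Commute.refl _).pow_right 3
  have h3 := commute_trans hG ha hw' hw1' h2 h1
  exact commute_trans hG ha hw hw1 ((Commute.refl u).pow_right 3) h3

/-- `b * i` is conjugate to `i⁻¹` -/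
theorem conj_step (hG : HypHStar G) {i b : G} (ha : Inv2 (i ^ 2)) (hb : Inv2 b) :
    ∃ t, b * i = t⁻¹ * i⁻¹ * t := by
  -- b = u a with u inverted by a
  have hn := (negBy_mul hG ha hb)
  set u := i ^ 2 * b with hu
  have hb' : b = i ^ 2 * u := by rw [hu, ← mul_assoc, ha.mul_self, one_mul]
  have hc := key9 hG ha hn
  -- v = i⁻¹ u i ; b i = a u i = a i v = i⁻¹ v (as i^4 = 1)
  set v := i⁻¹ * u * i with hv
  have hia : Commute i (i ^ 2) := (Commute.refl i).pow_right 2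
  have hvn : NegBy (i ^ 2) v := hn.conj hia
  have hi3 : i ^ 2 * i = i⁻¹ := by
    have := ha.mul_self
    rw [eq_inv_iff_mul_eq_one]
    rw [← this]; simp only [pow_two]; group
  -- i v i⁻¹ = u
  have huv : i * v * i⁻¹ = u := by rw [hv]; group
  have huu : i * u * i⁻¹ = v⁻¹ := by
    have h1 := hvn.1
    rw [← h1]
    have : i ^ 2 * v * i ^ 2 = i * (i * v * i⁻¹) * i⁻¹ * (i ^ 2 * i ^ 2) := by
      simp [pow_two, mul_assoc]
    rw [this, ha.mul_self, huv, mul_one]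
  have hv9 := hvn.2
  have hu9 := hn.2
  -- t = (v u)^5 : i t⁻¹ i⁻¹ t = v
  refine ⟨v ^ 5 * u ^ 5, ?_⟩
  have hbi : b * i = i⁻¹ * v := by
    rw [hb']
    have : i ^ 2 * u * i = i ^ 2 * i * v := by rw [hv]; group
    rw [this, hi3]
  have hconj : i * (v ^ 5 * u ^ 5) * i⁻¹ = u ^ 5 * (v ^ 5)⁻¹ := by
    have : i * (v ^ 5 * u ^ 5) * i⁻¹ = (i * v ^ 5 * i⁻¹) * (i * u ^ 5 * i⁻¹) := by group
    rw [this, ← conj_pow, ← conj_pow, huv, huu, inv_pow]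
  have hfin : i * (v ^ 5 * u ^ 5)⁻¹ * i⁻¹ * (v ^ 5 * u ^ 5) = v := by
    have : i * (v ^ 5 * u ^ 5)⁻¹ * i⁻¹ = (i * (v ^ 5 * u ^ 5) * i⁻¹)⁻¹ := by group
    rw [this, hconj]
    have hc5 : Commute (u ^ 5) (v ^ 5) := hc.pow_pow 5 5
    calc (u ^ 5 * (v ^ 5)⁻¹)⁻¹ * (v ^ 5 * u ^ 5) = v ^ 5 * (u ^ 5)⁻¹ * (v ^ 5 * u ^ 5) := by group
      _ = v ^ 5 * (u ^ 5)⁻¹ * (u ^ 5 * v ^ 5) := by rw [hc5.eq]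
      _ = v ^ 9 * v := by group
      _ = v := by rw [hv9, one_mul]
  rw [hbi]
  nth_rewrite 1 [← hfin]
  group

theorem mul_conj_sq (hG : HypHStar G) {i : G} (ha : Inv2 (i ^ 2)) (t : G) :
    (t⁻¹ * i * t * i) ^ 2 = 1 := by
  obtain ⟨c, u, hc, hu, hcu, -⟩ := decomp hG ha t
  have hia : Commute i (i ^ 2) := (Commute.refl i).pow_right 2
  have hci : Commute c i := comm_centralizer hG ha hc hia
  have e1 : t⁻¹ * i * t = u⁻¹ * i * u := by
    rw [hcu]
    calc (c * u)⁻¹ * i * (c * u) = u⁻¹ * (c⁻¹ * (i * c)) * u := by group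
      _ = _ := by rw [← hci.eq]; group
  rw [e1]
  have hk := key9 hG ha hu
  set v := i⁻¹ * u * i with hv
  have hvn : NegBy (i ^ 2) v := hu.conj hia
  -- u⁻¹ i u i = u⁻¹ a v
  have e2 : u⁻¹ * i * u * i = u⁻¹ * i ^ 2 * v := by rw [hv, pow_two]; group
  have e3 : (u⁻¹ * i ^ 2 * v) ^ 2 =
      u⁻¹ * (i ^ 2 * v * (i ^ 2)) * ((i ^ 2)⁻¹ * u⁻¹ * (i ^ 2)) * v := by
    simp only [pow_two (u⁻¹ * i ^ 2 * v)]; group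
  have e4 := (hu.inv ha).1
  rw [inv_inv] at e4
  rw [e2, e3, ha.inv_eq, hvn.1, e4]
  calc u⁻¹ * v⁻¹ * u * v = u⁻¹ * v⁻¹ * (u * v) := by group
    _ = u⁻¹ * v⁻¹ * (v * u) := by rw [hk.eq]
    _ = 1 := by group

theorem conj_of_inv (hG : HypHStar G) {a b : G} (ha : Inv2 a) (hb : Inv2 b) :
    ∃ t, b = t⁻¹ * a * t := by
  have hn := negBy_mul hG ha hb
  set x := a * b with hx
  have hu := hn.pow ha 5
  refine ⟨x ^ 5, ?_⟩
  have e1 : x ^ 5 * x ^ 5 = x := by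
    rw [← pow_add, show 5 + 5 = 9 + 1 by norm_num, pow_succ, hn.2, one_mul]
  have e3 : (x ^ 5)⁻¹ * a = a * x ^ 5 := by
    rw [← hu.1, mul_assoc, ha.mul_self, mul_one]
  rw [e3, mul_assoc, e1, hx, ← mul_assoc, ha.mul_self, one_mul]

/-- the product of three involutions squares to 1 -/
theorem three_inv (hG : HypHStar G) {a b c : G} (ha : Inv2 a) (hb : Inv2 b) (hc : Inv2 c) :
    (a * b * c) ^ 2 = 1 := by
  by_cases hex : ∃ i : G, Inv2 (i ^ 2)
  · obtain ⟨i, hi⟩ := hex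
    have aux : ∀ j : G, Inv2 (j ^ 2) → ∀ t : G, Inv2 ((t⁻¹ * j * t) ^ 2) := by
      intro j hj t
      have := hj.conj t
      convert this using 1
      simp only [pow_two]; group
    have auxi : Inv2 ((i⁻¹) ^ 2) := by rw [inv_pow, hi.inv_eq]; exact hi
    obtain ⟨t1, h1⟩ := conj_step hG hi hc
    obtain ⟨t2, h2⟩ := conj_step hG (aux _ auxi t1) hb
    obtain ⟨t3, h3⟩ := conj_step hG (aux _ (by
      have := aux _ auxi t1
      rw [inv_pow, this.inv_eq]; exact this) t2) ha
    have h4 : a * b * c = ((t1 * t2 * t3)⁻¹ * i⁻¹ * (t1 * t2 * t3)) * i⁻¹ := by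
      have : a * b * c = a * (b * (c * i)) * i⁻¹ := by group
      rw [this, h1, h2, h3]; group
    rw [h4]
    exact mul_conj_sq hG auxi _
  · push Not at hex
    obtain ⟨d, u, hd, hu, hdu, -⟩ := decomp hG ha (b * c)
    have hd' : d = 1 ∨ d = a := by
      by_cases hd1 : d = 1
      · exact Or.inl hd1
      obtain ⟨k, hk⟩ := pow_eq_of_commute hG ha hd hd1
      cases k with
      | zero => right; simpa using hk
      | succ k =>
        exact absurd (by rw [← pow_mul, ← pow_succ, hk]; exact ha) (hex (d ^ 2 ^ k))
    rcases hd' with h | h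
    · rw [h, one_mul] at hdu
      rw [mul_assoc, hdu]
      exact (hu.inv2 ha).2
    · have h1 : (b * c) ^ 2 = 1 := by rw [hdu, h]; exact (hu.inv2 ha).2
      have h2 := inv_mul_inv hG hb hc
      have h3 : b * c = 1 := by
        rw [show 9 = 2 * 4 + 1 by norm_num, pow_succ, pow_mul, h1, one_pow, one_mul] at h2
        exact h2
      rw [mul_assoc, h3, mul_one]; exact ha.2

theorem NegBy.mul (hG : HypHStar G) {a x y : G} (ha : Inv2 a) (hx : NegBy a x) (hy : NegBy a y) :
    NegBy a (x * y) := by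
  refine ⟨?_, ?_⟩
  · have h := three_inv hG (hx.inv2 ha) ha (hy.inv2 ha)
    have : a * x * a * (a * y) = a * (x * y) := by
      have : a * x * a * (a * y) = a * x * (a * a) * y := by group
      rw [this, ha.mul_self]; group
    rw [this, pow_two, ← mul_assoc] at h
    exact eq_inv_of_mul_eq_one_left h
  · have h := inv_mul_inv hG (hx.inv2' ha) (hy.inv2 ha)
    have : x * a * (a * y) = x * (a * a) * y := by group
    rw [this, ha.mul_self, mul_one] at h
    exact h

/-- the abelian normal subgroup of elements inverted by `a` -/
def kern (hG : HypHStar G) {a : G} (ha : Inv2 a) : Subgroup G where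
  carrier := {x | NegBy a x}
  mul_mem' hx hy := NegBy.mul hG ha hx hy
  one_mem' := ⟨by rw [mul_one, ha.mul_self, inv_one], one_pow _⟩
  inv_mem' hx := hx.inv ha

theorem kern_comm (hG : HypHStar G) {a : G} (ha : Inv2 a) {x y : G} (hx : x ∈ kern hG ha)
    (hy : y ∈ kern hG ha) : Commute x y :=
  commute_of_neg ha hx hy (NegBy.mul hG ha hx hy)

theorem kern_normal (hG : HypHStar G) {a : G} (ha : Inv2 a) : (kern hG ha).Normal := by
  constructor
  intro n hn g
  obtain ⟨c, u, hc, hu, hcu, -⟩ := decomp hG ha g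
  have hc1 := kern_comm hG ha (x := u) hu hn
  have : g * n * g⁻¹ = c⁻¹⁻¹ * n * c⁻¹ := by
    rw [hcu]
    calc c * u * n * (c * u)⁻¹ = c * (u * n) * u⁻¹ * c⁻¹ := by group
      _ = c * (n * u) * u⁻¹ * c⁻¹ := by rw [hc1.eq]
      _ = _ := by group
  rw [this]
  exact NegBy.conj hn hc.inv_left

theorem kern_commutator (hG : HypHStar G) {a : G} (ha : Inv2 a) (s t : G) :
    (s * t)⁻¹ * (t * s) ∈ kern hG ha := by
  have := kern_normal hG ha
  obtain ⟨c, u, hc, hu, hcu, -⟩ := decomp hG ha s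
  obtain ⟨d, w, hd, hw, hdw, -⟩ := decomp hG ha t
  rw [← QuotientGroup.eq]
  have e1 : ((s : G) : G ⧸ kern hG ha) = (c : G) := by
    rw [eq_comm, QuotientGroup.eq, hcu, inv_mul_cancel_left]; exact hu
  have e2 : ((t : G) : G ⧸ kern hG ha) = (d : G) := by
    rw [eq_comm, QuotientGroup.eq, hdw, inv_mul_cancel_left]; exact hw
  rw [QuotientGroup.mk_mul, QuotientGroup.mk_mul, e1, e2, ← QuotientGroup.mk_mul,
    ← QuotientGroup.mk_mul, (comm_centralizer hG ha hc hd).eq]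

theorem exists_inv (hG : HypHStar G) : ∃ a : G, Inv2 a := by
  obtain ⟨g, hg⟩ := (hG.1.2.1 2 Nat.prime_two).2 (Or.inl rfl)
  have h := hG.1.1 g
  refine ⟨g ^ (orderOf g / 2), ?_, ?_⟩
  · have hpos := h.orderOf_pos
    apply pow_ne_one_of_lt_orderOf <;> omega
  · rw [← pow_mul, Nat.div_mul_cancel hg, pow_orderOf_eq_one]

end HStar

/-- A group satisfying hypothesis (H*) is locally finite. -/
theorem statement_1 (G : Type*) [Group G] (hG : HypHStar G) :
    ∀ S : Subgroup G, S.FG → Finite S := by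
  intro S hS
  obtain ⟨a, ha⟩ := exists_inv hG
  have hSfg : Group.FG S := (Group.fg_iff_subgroup_fg S).2 hS
  have hnorm := kern_normal hG ha
  let K : Subgroup S := (kern hG ha).subgroupOf S
  have htor : ∀ s : S, IsOfFinOrder s := fun s => by
    rw [← Submonoid.isOfFinOrder_coe]; exact hG.1.1 _
  have hq : Finite (S ⧸ K) := by
    let _ : CommGroup (S ⧸ K) :=
      { (inferInstance : Group (S ⧸ K)) with
        mul_comm := by
          intro x y
          induction x using QuotientGroup.induction_on with | _ s
          induction y using QuotientGroup.induction_on with | _ t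
          rw [← QuotientGroup.mk_mul, ← QuotientGroup.mk_mul, QuotientGroup.eq]
          exact kern_commutator hG ha s.1 t.1 }
    have : Group.FG (S ⧸ K) := inferInstance
    apply CommGroup.finite_of_fg_torsion
    intro x
    induction x using QuotientGroup.induction_on with | _ s
    exact (QuotientGroup.mk' K).isOfFinOrder (htor s)
  have hfi : K.FiniteIndex := Subgroup.finiteIndex_of_finite_quotient
  have hKfg : Group.FG K := Subgroup.fg_of_index_ne_zero K
  have hK : Finite K := by
    let _ : CommGroup K :=
      { (inferInstance : Group K) with
        mul_comm := by
          intro x y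
          apply Subtype.ext
          apply Subtype.ext
          exact kern_comm hG ha x.2 y.2 }
    apply CommGroup.finite_of_fg_torsion
    intro x
    have := htor x.1
    exact Submonoid.isOfFinOrder_coe.1 this
  exact Finite.of_subgroup_quotient K
end

section
/- Let G be a group satisfying hypothesis (H*). Let a be an involution of G, let x ∈ G have order 3 with a * x * a⁻¹ = x⁻¹, and let t ∈ G have order 4 with t^2 = a. Then the subgroup H = ⟨t, x⟩ generated by t and x has cardinality 36; the subgroup P = ⟨x, t * x * t⁻¹⟩ is commutative, normal in H, has cardinality 9, every element p of P satisfies p^3 = 1, and P ⊓ ⟨t⟩ = ⊥ with P ⊔ ⟨t⟩ = H (so H is the semidirect product of P by the cyclic group ⟨t⟩ of order 4). -/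
theorem aux_pow_congr {G α : Type*} [Group G] [MulAction G α] {s : G} (hs : s ^ 9 = 1)
    {i j : ℕ} (h : i % 9 = j % 9) (p : α) : s ^ i • p = s ^ j • p := by
  rw [pow_eq_pow_mod i hs, pow_eq_pow_mod j hs, h]

/-- Partial coset enumeration: in the group `⟨s, x | x³, s⁹, (x s⁻²)², (x s⁻¹)⁴⟩` the element
`(x⁻¹ s x s⁻¹)⁸` fixes every point fixed by `s`. -/
theorem aux_enum {G α : Type*} [Group G] [MulAction G α] (s x : G) (hs : s ^ 9 = 1)
    (hx : x ^ 3 = 1) (h2 : (x * (s ^ 2)⁻¹) ^ 2 = 1) (h4 : (x * s⁻¹) ^ 4 = 1)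
    (P0 : α) (h0 : s • P0 = P0) : (x⁻¹ * s * x * s⁻¹) ^ 8 • P0 = P0 := by
  have ex1 : ∀ p : α, ∃ q : α, x • p = s ^ 0 • q := fun p => ⟨x • p, by simp⟩
  have ex2 : ∀ p : α, ∃ q : α, x • s ^ 0 • q = p := fun p => ⟨x⁻¹ • p, by simp⟩
  have r2 : ∀ {i j k l : ℕ} {P Q : α}, x • s ^ i • P = s ^ j • Q →
      (k + 2) % 9 = j % 9 → l % 9 = (i + 2) % 9 → x • s ^ k • Q = s ^ l • P := by
    intro i j k l P Q h hk hl
    have e1 : s ^ k • Q = (s ^ 2)⁻¹ • s ^ j • Q := by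
      rw [eq_inv_smul_iff, smul_smul, ← pow_add]
      exact aux_pow_congr hs (by omega) _
    have e2 : s ^ i • P = (s ^ 2)⁻¹ • s ^ l • P := by
      rw [eq_inv_smul_iff, smul_smul, ← pow_add]
      exact aux_pow_congr hs (by omega) _
    have := congrArg (· • s ^ l • P) h2
    simp only [pow_two (x * _), one_smul, mul_smul] at this
    rw [← e2, h, ← e1] at this
    exact this
  have r3 : ∀ {P Q R : α}, x • P = Q → x • Q = R → x • R = P := by
    intro P Q R h h'
    rw [← h', ← h, smul_smul, smul_smul, ← pow_two, ← pow_succ, hx, one_smul]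
  have r4 : ∀ {a b c d e f g h : ℕ} {P Q R T : α}, x • s ^ a • P = s ^ b • Q →
      x • s ^ c • Q = s ^ d • R → x • s ^ e • R = s ^ f • T →
      b % 9 = (c + 1) % 9 → d % 9 = (e + 1) % 9 → f % 9 = (g + 1) % 9 → h % 9 = (a + 1) % 9 →
      x • s ^ g • T = s ^ h • P := by
    intro a b c d e f g h P Q R T h1 h2 h3 hb hd hf hh
    have key : ∀ {i j : ℕ} (q : α), j % 9 = (i + 1) % 9 → s ^ i • q = s⁻¹ • s ^ j • q := by
      intro i j q hij
      rw [eq_inv_smul_iff, smul_smul, ← pow_succ']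
      exact aux_pow_congr hs (by omega) _
    have := congrArg (· • s ^ h • P) h4
    simp only [pow_succ (x * _), pow_zero, one_mul, one_smul, mul_smul] at this
    rw [← key P hh, h1, ← key Q hb, h2, ← key R hd, h3, ← key T hf] at this
    exact this
  have vs : ∀ {i j k l m : ℕ} {P Q R : α}, x • s ^ i • P = s ^ j • Q →
      x • s ^ k • R = s ^ l • Q → m % 9 = (i + 1) % 9 → l % 9 = (j + 1) % 9 →
      (x⁻¹ * s * x * s⁻¹) • s ^ m • P = s ^ k • R := by
    intro i j k l m P Q R h1 h2 hm hl
    have e1 : s⁻¹ • s ^ m • P = s ^ i • P := by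
      rw [inv_smul_eq_iff, smul_smul, ← pow_succ']
      exact aux_pow_congr hs (by omega) _
    rw [mul_smul, mul_smul, mul_smul, e1, h1, inv_smul_eq_iff, h2, smul_smul, ← pow_succ']
    exact aux_pow_congr hs (by omega) _
  have hP : ∀ i : ℕ, s ^ i • P0 = P0 := by
    intro i
    induction i with
    | zero => simp
    | succ n ih => rw [pow_succ, mul_smul, h0, ih]
  obtain ⟨P1, e0⟩ : ∃ q, x • s ^ 0 • P0 = s ^ 0 • q := ex1 _
  have e1 : x • s ^ 7 • P1 = s ^ 1 • P0 := by
    rw [hP, ← hP 2]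
    exact r2 e0 rfl rfl
  obtain ⟨P2, e13⟩ : ∃ q, x • s ^ 0 • q = s ^ 1 • P1 := ex2 _
  have e3 : x • s ^ 8 • P1 = s ^ 2 • P2 := r2 e13 rfl rfl
  have e5 : x • s ^ 1 • P2 = s ^ 8 • P1 := r4 e1 e0 e3 rfl rfl rfl rfl
  have e4 : x • s ^ 2 • P2 = s ^ 1 • P2 := r3 e5 e3
  have e14 : x • s ^ 8 • P2 = s ^ 4 • P2 := r2 e4 rfl rfl
  obtain ⟨P3, e16⟩ : ∃ q, x • s ^ 6 • P2 = s ^ 0 • q := ex1 _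
  have e38 : x • s ^ 7 • P3 = s ^ 8 • P2 := r2 e16 rfl rfl
  have e18 : x • s ^ 4 • P2 = s ^ 7 • P3 := r3 e38 e14
  have e48 : x • s ^ 5 • P3 = s ^ 6 • P2 := r2 e18 rfl rfl
  have e40 : x • s ^ 0 • P3 = s ^ 5 • P3 := r3 e48 e16
  have e81 : x • s ^ 3 • P3 = s ^ 2 • P3 := r2 e40 rfl rfl
  obtain ⟨P4, e52⟩ : ∃ q, x • s ^ 0 • q = s ^ 5 • P2 := ex2 _
  obtain ⟨P5, e54⟩ : ∃ q, x • s ^ 8 • P4 = s ^ 0 • q := ex1 _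
  have e41 : x • s ^ 7 • P5 = s ^ 1 • P4 := r2 e54 rfl rfl
  have e49 : x • s ^ 6 • P3 = s ^ 8 • P5 := r4 e41 e52 e18 rfl rfl rfl rfl
  have e42 : x • s ^ 6 • P5 = s ^ 8 • P3 := r2 e49 rfl rfl
  obtain ⟨P6, e22⟩ : ∃ q, x • s ^ 0 • q = s ^ 0 • P2 := ex2 _
  have e15 : x • s ^ 7 • P2 = s ^ 2 • P6 := r2 e22 rfl rfl
  have e35 : x • s ^ 1 • P6 = s ^ 7 • P5 := r4 e42 e38 e15 rfl rfl rfl rfl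
  obtain ⟨P7, e105⟩ : ∃ q, x • s ^ 0 • q = s ^ 1 • P5 := ex2 _
  have e53 : x • s ^ 8 • P5 = s ^ 2 • P7 := r2 e105 rfl rfl
  have e51 : x • s ^ 2 • P7 = s ^ 6 • P3 := r3 e49 e53
  have e80 : x • s ^ 4 • P3 = s ^ 4 • P7 := r2 e51 rfl rfl
  obtain ⟨P8, e46⟩ : ∃ q, x • s ^ 0 • q = s ^ 6 • P5 := ex2 _
  have e39 : x • s ^ 8 • P3 = s ^ 0 • P8 := r3 e46 e42
  have e97 : x • s ^ 7 • P8 = s ^ 1 • P3 := r2 e39 rfl rfl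
  obtain ⟨P9, e106⟩ : ∃ q, x • s ^ 8 • P7 = s ^ 0 • q := ex1 _
  obtain ⟨P10, e218⟩ : ∃ q, x • s ^ 0 • q = s ^ 1 • P9 := ex2 _
  obtain ⟨P11, e178⟩ : ∃ q, x • s ^ 8 • P10 = s ^ 0 • q := ex1 _
  have e226 : x • s ^ 7 • P11 = s ^ 1 • P10 := r2 e178 rfl rfl
  obtain ⟨P12, e83⟩ : ∃ q, x • s ^ 1 • P3 = s ^ 0 • q := ex1 _
  have e169 : x • s ^ 0 • P12 = s ^ 7 • P8 := r3 e97 e83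
  have e99 : x • s ^ 5 • P8 = s ^ 2 • P12 := r2 e169 rfl rfl
  have e168 : x • s ^ 7 • P12 = s ^ 3 • P3 := r2 e83 rfl rfl
  have e82 : x • s ^ 2 • P3 = s ^ 7 • P12 := r3 e168 e81
  have e166 : x • s ^ 5 • P12 = s ^ 4 • P3 := r2 e82 rfl rfl
  have e102 : x • s ^ 4 • P7 = s ^ 5 • P12 := r3 e166 e80
  have e232 : x • s ^ 3 • P12 = s ^ 6 • P7 := r2 e102 rfl rfl
  have e170 : x • s ^ 8 • P12 = s ^ 6 • P12 := r4 e166 e81 e83 rfl rfl rfl rfl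
  have e202 : x • s ^ 4 • P12 = s ^ 1 • P12 := r2 e170 rfl rfl
  obtain ⟨P13, e200⟩ : ∃ q, x • s ^ 1 • P12 = s ^ 0 • q := ex1 _
  have e206 : x • s ^ 0 • P13 = s ^ 4 • P12 := r3 e202 e200
  have e201 : x • s ^ 2 • P12 = s ^ 2 • P13 := r2 e206 rfl rfl
  have e208 : x • s ^ 2 • P13 = s ^ 5 • P8 := r3 e99 e201
  have e101 : x • s ^ 3 • P8 = s ^ 4 • P13 := r2 e208 rfl rfl
  have e225 : x • s ^ 7 • P13 = s ^ 3 • P12 := r2 e200 rfl rfl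
  have e108 : x • s ^ 6 • P7 = s ^ 7 • P13 := r3 e225 e232
  have e223 : x • s ^ 5 • P13 = s ^ 8 • P7 := r2 e108 rfl rfl
  have e219 : x • s ^ 0 • P9 = s ^ 5 • P13 := r3 e223 e106
  have e210 : x • s ^ 4 • P13 = s ^ 8 • P11 := r4 e226 e218 e219 rfl rfl rfl rfl
  have e217 : x • s ^ 8 • P11 = s ^ 3 • P8 := r3 e101 e210
  have e89 : x • s ^ 1 • P8 = s ^ 1 • P11 := r2 e217 rfl rfl
  have e0b : x • s ^ 8 • P0 = s ^ 0 • P1 := by rw [← e0, hP, hP]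
  have v1 := vs (m := 0) e0b e13 rfl rfl
  have v2 := vs (m := 0) e14 e52 rfl rfl
  have v3 := vs (m := 0) e54 e105 rfl rfl
  have v4 := vs (m := 0) e106 e218 rfl rfl
  have v5 := vs (m := 0) e178 e89 rfl rfl
  have v6 := vs (m := 1) e46 e35 rfl rfl
  have v7 := vs (m := 1) e22 e4 rfl rfl
  have v8 := vs (m := 2) e5 e0 rfl rfl
  have hfin : ∀ (v : G) (p : α), v ^ 8 • p = v • v • v • v • v • v • v • v • p := by
    intro v p
    simp only [pow_succ, pow_zero, one_mul, mul_smul]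
  have hstart : s ^ 0 • P0 = P0 := hP 0
  rw [← hstart, hfin, v1, v2, v3, v4, v5, v6, v7, v8]

theorem aux_comm_invol {G : Type*} [Group G] (hG : HypHStar G) {i j : G} (hi1 : i ≠ 1)
    (hi : i ^ 2 = 1) (hj1 : j ≠ 1) (hj : j ^ 2 = 1) (hij : i * j = j * i) : i = j := by
  classical
  have hC := (hG.2 i hi1 hi).2
  let I : Subgroup.centralizer {i} := ⟨i, by rw [Subgroup.mem_centralizer_singleton_iff]⟩
  let J : Subgroup.centralizer {i} :=
    ⟨j, by rw [Subgroup.mem_centralizer_singleton_iff]; first | exact hij | exact hij.symm⟩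
  have hcyc := hC (Subgroup.closure {I, J}) ⟨{I, J}, by simp⟩
  obtain ⟨g, hg⟩ := hcyc.exists_generator
  obtain ⟨m, hm⟩ := Subgroup.mem_zpowers_iff.1
    (hg ⟨I, Subgroup.subset_closure (by simp)⟩)
  obtain ⟨n, hn⟩ := Subgroup.mem_zpowers_iff.1
    (hg ⟨J, Subgroup.subset_closure (by simp)⟩)
  have hm' : (g : G) ^ m = i := by
    have := congrArg (fun z : Subgroup.closure {I, J} => ((z : Subgroup.centralizer {i}) : G)) hm
    simpa [I] using this
  have hn' : (g : G) ^ n = j := by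
    have := congrArg (fun z : Subgroup.closure {I, J} => ((z : Subgroup.centralizer {i}) : G)) hn
    simpa [J] using this
  generalize ((g : Subgroup.centralizer {i}) : G) = w at hm' hn'
  have h1 : (orderOf w : ℤ) ∣ m * 2 := by
    rw [orderOf_dvd_iff_zpow_eq_one, zpow_mul, hm']; exact_mod_cast hi
  have h2 : (orderOf w : ℤ) ∣ n * 2 := by
    rw [orderOf_dvd_iff_zpow_eq_one, zpow_mul, hn']; exact_mod_cast hj
  have h3 : ¬ (orderOf w : ℤ) ∣ m := by
    rw [orderOf_dvd_iff_zpow_eq_one, hm']; exact hi1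
  have h4 : ¬ (orderOf w : ℤ) ∣ n := by
    rw [orderOf_dvd_iff_zpow_eq_one, hn']; exact hj1
  obtain ⟨c, hc⟩ := h1
  obtain ⟨d, hd⟩ := h2
  have h5 : (orderOf w : ℤ) ∣ m - n := by
    rcases Int.even_or_odd' c with ⟨c', rfl | rfl⟩
    · exact absurd ⟨c', by linarith⟩ h3
    rcases Int.even_or_odd' d with ⟨d', rfl | rfl⟩
    · exact absurd ⟨d', by linarith⟩ h4
    exact ⟨c' - d', by linarith⟩
  rw [orderOf_dvd_iff_zpow_eq_one, zpow_sub, hm', hn'] at h5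
  exact mul_inv_eq_one.1 h5

theorem aux_no_three {G : Type*} [Group G] (hG : HypHStar G) {i y : G} (hi1 : i ≠ 1)
    (hi : i ^ 2 = 1) (hc : i * y = y * i) (h3 : 3 ∣ orderOf y) : False := by
  obtain ⟨n, hn⟩ := (hG.2 i hi1 hi).1
    ⟨y, by rw [Subgroup.mem_centralizer_singleton_iff]; first | exact hc | exact hc.symm⟩
  rw [Subgroup.orderOf_mk] at hn
  rw [hn] at h3
  have := Nat.prime_three.dvd_of_dvd_pow h3
  omega

theorem aux_orders {G : Type*} [Group G] (hG : HypHStar G) (g : G) (h9 : orderOf g ≤ 9) :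
    g ^ 9 = 1 ∨ g ^ 4 = 1 ∨ orderOf g = 8 := by
  have hpos : 0 < orderOf g := (hG.1.1 g).orderOf_pos
  have h5 : ¬ 5 ∣ orderOf g := fun h => by
    have := (hG.1.2.1 5 (by norm_num)).1 ⟨g, h⟩
    omega
  have h7 : ¬ 7 ∣ orderOf g := fun h => by
    have := (hG.1.2.1 7 (by norm_num)).1 ⟨g, h⟩
    omega
  have h6 : orderOf g ≠ 6 := fun h => by
    have h1 : g ^ 6 = 1 := by rw [← h]; exact pow_orderOf_eq_one g
    have h2 : g ^ 3 ≠ 1 := by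
      intro h'
      have := Nat.le_of_dvd (by norm_num) (orderOf_dvd_of_pow_eq_one h')
      omega
    exact aux_no_three hG (i := g ^ 3) (y := g) h2 (by rw [← pow_mul]; exact h1)
      (by rw [← pow_succ, ← pow_succ']) (by rw [h]; norm_num)
  have key : orderOf g ∣ 9 ∨ orderOf g ∣ 4 ∨ orderOf g = 8 := by
    generalize orderOf g = n at *
    interval_cases n <;> omega
  rcases key with h | h | h
  · exact Or.inl (orderOf_dvd_iff_pow_eq_one.1 h)
  · exact Or.inr (Or.inl (orderOf_dvd_iff_pow_eq_one.1 h))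
  · exact Or.inr (Or.inr h)

theorem aux_two_invol {G : Type*} [Group G] (hG : HypHStar G) {i j : G} (hi1 : i ≠ 1)
    (hi : i ^ 2 = 1) (hj1 : j ≠ 1) (hj : j ^ 2 = 1) : (i * j) ^ 9 = 1 := by
  have hoi : orderOf i ≤ 4 := by rw [orderOf_eq_prime hi hi1]; norm_num
  have hoj : orderOf j ≤ 4 := by rw [orderOf_eq_prime hj hj1]; norm_num
  have h9 := hG.1.2.2 i j hoi hoj
  have hpos : 0 < orderOf (i * j) := (hG.1.1 _).orderOf_pos
  by_cases hev : 2 ∣ orderOf (i * j)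
  · exfalso
    obtain ⟨k, hk⟩ := hev
    have hc1 : (i * j) ^ k ≠ 1 := by
      intro h
      have := Nat.le_of_dvd (by omega) (orderOf_dvd_of_pow_eq_one h)
      omega
    have hc2 : ((i * j) ^ k) ^ 2 = 1 := by
      rw [← pow_mul, mul_comm k 2, ← hk]; exact pow_orderOf_eq_one _
    have hii : i⁻¹ = i := by rw [inv_eq_iff_mul_eq_one, ← pow_two, hi]
    have hjj : j⁻¹ = j := by rw [inv_eq_iff_mul_eq_one, ← pow_two, hj]
    have hcc : ((i * j) ^ k)⁻¹ = (i * j) ^ k := by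
      rw [inv_eq_iff_mul_eq_one, ← pow_two, hc2]
    have hconj : i * (i * j) ^ k * i⁻¹ = (i * j) ^ k := by
      rw [← conj_pow, ← hcc, ← inv_pow]
      congr 1
      rw [mul_inv_rev, hii, hjj, ← mul_assoc, ← pow_two, hi, one_mul]
    have hci : i = (i * j) ^ k := aux_comm_invol hG hi1 hi hc1 hc2 (mul_inv_eq_iff_eq_mul.1 hconj)
    have hcom : i * (i * j) = (i * j) * i := by
      have h' : Commute ((i * j) ^ k) (i * j) := (Commute.refl (i * j)).pow_left k
      rw [← hci] at h'
      exact h'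
    have hij : i * j = j * i := by
      have h' : i * (i * j) = i * (j * i) := by rw [hcom, mul_assoc]
      exact mul_left_cancel h'
    have heq := aux_comm_invol hG hi1 hi hj1 hj hij
    rw [← heq, ← pow_two, hi] at hk
    simp at hk
    omega
  · rcases aux_orders hG _ h9 with h | h | h
    · exact h
    · have h4 : orderOf (i * j) ∣ 2 ^ 2 := orderOf_dvd_of_pow_eq_one h
      rw [Nat.dvd_prime_pow Nat.prime_two] at h4
      obtain ⟨m, -, hm⟩ := h4
      rcases m with _ | m
      · rw [pow_zero, orderOf_eq_one_iff] at hm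
        rw [hm, one_pow]
      · exact absurd ⟨2 ^ m, by rw [hm, pow_succ']⟩ hev
    · exact absurd ⟨4, h⟩ hev

theorem aux_card_sup {G : Type*} [Group G] (A B : Subgroup G) (h : A ⊓ B = ⊥)
    (hn : B ≤ Subgroup.normalizer A) :
    Nat.card (A ⊔ B : Subgroup G) = Nat.card A * Nat.card B := by
  rw [← Nat.card_prod]
  have hinj := Subgroup.mul_injective_of_disjoint (disjoint_iff.2 h)
  have hr : Set.range (fun g : A × B => (g.1 : G) * g.2) = ((A ⊔ B : Subgroup G) : Set G) := by
    rw [Subgroup.coe_mul_of_right_le_normalizer_left A B hn]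
    ext z
    simp [Set.mem_mul]
  have := Nat.card_range_of_injective hinj
  rw [hr] at this
  exact this

/-- The structure of `H` once `x` and `t x t⁻¹` commute. -/
theorem aux_final {G : Type*} [Group G] (a x y t : G)
    (hx : orderOf x = 3) (hax : a * x * a⁻¹ = x⁻¹)
    (ht : orderOf t = 4) (hta : t ^ 2 = a) (hy : t * x * t⁻¹ = y) (hty : t * y * t⁻¹ = x⁻¹)
    (hxy : x * y = y * x) :
    Nat.card (Subgroup.closure {t, x} : Subgroup G) = 36 ∧
    (∀ p ∈ Subgroup.closure {x, y}, ∀ q ∈ Subgroup.closure {x, y}, p * q = q * p) ∧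
    ((Subgroup.closure {x, y}).subgroupOf (Subgroup.closure {t, x})).Normal ∧
    Nat.card (Subgroup.closure {x, y} : Subgroup G) = 9 ∧
    (∀ p ∈ Subgroup.closure {x, y}, p ^ 3 = 1) ∧
    Subgroup.closure {x, y} ⊓ Subgroup.zpowers t = ⊥ ∧
    Subgroup.closure {x, y} ⊔ Subgroup.zpowers t = Subgroup.closure {t, x} := by
  have hx3 : x ^ 3 = 1 := by rw [← hx]; exact pow_orderOf_eq_one x
  have ht4 : t ^ 4 = 1 := by rw [← ht]; exact pow_orderOf_eq_one t
  have hx1 : x ≠ 1 := by rintro rfl; simp at hx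
  have hy3 : y ^ 3 = 1 := by rw [← hy, conj_pow, hx3]; simp
  have hy1 : y ≠ 1 := by
    rintro rfl
    simp at hty
    exact hx1 hty
  have hoy : orderOf y = 3 := by
    have : Fact (Nat.Prime 3) := ⟨Nat.prime_three⟩
    exact orderOf_eq_prime hy3 hy1
  have hxinv : x ≠ x⁻¹ := by
    intro h
    have h2 : x ^ 2 = 1 := by rw [pow_two]; exact mul_eq_one_iff_eq_inv.2 h
    have := Nat.le_of_dvd (by norm_num) (orderOf_dvd_of_pow_eq_one h2)
    omega
  have hyx : y ≠ x := by
    intro h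
    rw [h] at hy hty
    exact hxinv (hy.symm.trans hty)
  have hyx' : y ≠ x⁻¹ := by
    intro h
    have h1 : t * x⁻¹ * t⁻¹ = (t * x * t⁻¹)⁻¹ := by group
    rw [h] at hty
    rw [hty, hy, h] at h1
    simp at h1
    exact hxinv h1.symm
  have hcomm : ∀ p ∈ Subgroup.closure {x, y}, ∀ q ∈ Subgroup.closure {x, y},
      p * q = q * p := by
    have hc : ∀ p ∈ ({x, y} : Set G), ∀ q ∈ ({x, y} : Set G), p * q = q * p := by
      intro p hp q hq
      simp only [Set.mem_insert_iff, Set.mem_singleton_iff] at hp hq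
      rcases hp with rfl | rfl <;> rcases hq with rfl | rfl <;> first | rfl | exact hxy | exact hxy.symm
    intro p hp q hq
    have hle : Subgroup.closure {x, y} ≤ Subgroup.centralizer ({x, y} : Set G) := by
      rw [Subgroup.closure_le]
      intro p hp
      rw [SetLike.mem_coe, Subgroup.mem_centralizer_iff]
      intro q hq
      exact hc q hq p hp
    have hle2 : Subgroup.closure {x, y} ≤ Subgroup.centralizer
        (Subgroup.closure {x, y} : Set G) := by
      rw [Subgroup.closure_le]
      intro r hr
      rw [SetLike.mem_coe, Subgroup.mem_centralizer_iff]
      intro q hq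
      exact (Subgroup.mem_centralizer_iff.1 (hle hq) r hr).symm
    exact Subgroup.mem_centralizer_iff.1 (hle2 hq) p hp
  have hcube : ∀ p ∈ Subgroup.closure {x, y}, p ^ 3 = 1 := by
    intro p hp
    induction hp using Subgroup.closure_induction with
    | mem p hp =>
      rcases hp with rfl | rfl
      · exact hx3
      · exact hy3
    | one => simp
    | mul p q hp hq ihp ihq =>
      have hpq : Commute p q := hcomm p hp q hq
      rw [hpq.mul_pow, ihp, ihq, one_mul]
    | inv p hp ihp => rw [inv_pow, ihp, inv_one]
  have hxP : x ∈ Subgroup.closure {x, y} := Subgroup.subset_closure (by simp)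
  have hyP : y ∈ Subgroup.closure {x, y} := Subgroup.subset_closure (by simp)
  have hinf : Subgroup.closure {x, y} ⊓ Subgroup.zpowers t = ⊥ := by
    rw [eq_bot_iff]
    rintro p ⟨hp, hpt⟩
    have h3 := hcube p hp
    obtain ⟨k, rfl⟩ := Subgroup.mem_zpowers_iff.1 hpt
    have h4 : (t ^ k) ^ 4 = 1 := by
      rw [← zpow_natCast, ← zpow_mul, mul_comm, zpow_mul]
      have : t ^ ((4 : ℕ) : ℤ) = 1 := by exact_mod_cast ht4
      rw [this, one_zpow]
    rw [Subgroup.mem_bot]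
    rw [pow_succ, h3, one_mul] at h4
    exact h4
  have hcl : Subgroup.closure {x, y} = Subgroup.zpowers x ⊔ Subgroup.zpowers y := by
    rw [Subgroup.zpowers_eq_closure, Subgroup.zpowers_eq_closure, ← Subgroup.closure_union]
    rfl
  have hP9 : Nat.card (Subgroup.closure {x, y} : Subgroup G) = 9 := by
    rw [hcl, aux_card_sup, Nat.card_zpowers, Nat.card_zpowers, hx, hoy]
    · classical
      rw [eq_bot_iff]
      rintro p ⟨hp, hpt⟩
      rw [Subgroup.mem_bot]
      have hfx : IsOfFinOrder x := orderOf_pos_iff.1 (by omega)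
      have hfy : IsOfFinOrder y := orderOf_pos_iff.1 (by omega)
      have hp' := (hfx.mem_zpowers_iff_mem_range_orderOf (y := p)).1 hp
      have hpt' := (hfy.mem_zpowers_iff_mem_range_orderOf (y := p)).1 hpt
      rw [hx] at hp'
      rw [hoy] at hpt'
      simp only [Finset.mem_image, Finset.mem_range] at hp' hpt'
      obtain ⟨i, hi, rfl⟩ := hp'
      obtain ⟨j, hj, hij⟩ := hpt'
      have hx2 : x ^ 2 = x⁻¹ := by rw [eq_inv_iff_mul_eq_one, ← pow_succ, hx3]
      have hy2 : y ^ 2 = y⁻¹ := by rw [eq_inv_iff_mul_eq_one, ← pow_succ, hy3]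
      have hyx'' : y⁻¹ ≠ x := fun h => hyx' (by rw [← h, inv_inv])
      interval_cases i <;> interval_cases j <;> simp_all
    · intro p hp
      apply Subgroup.centralizer_le_normalizer
      rw [Subgroup.mem_centralizer_iff]
      intro q hq
      apply hcomm
      · rw [hcl]; exact Subgroup.mem_sup_left hq
      · rw [hcl]; exact Subgroup.mem_sup_right hp
  have htN : t ∈ Subgroup.normalizer (Subgroup.closure {x, y} : Set G) := by
    have h1 : ∀ p ∈ Subgroup.closure {x, y}, t * p * t⁻¹ ∈ Subgroup.closure {x, y} := by
      intro p hp
      have hle : Subgroup.closure {x, y} ≤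
          (Subgroup.closure {x, y}).comap (MulAut.conj t).toMonoidHom := by
        rw [Subgroup.closure_le]
        rintro q (rfl | rfl)
        · simp [hy, hyP]
        · simp [hty, hxP]
      simpa using hle hp
    rw [Subgroup.mem_normalizer_iff]
    intro p
    refine ⟨h1 p, fun hp => ?_⟩
    have h2 := h1 _ (h1 _ (h1 _ hp))
    have h3 : t * (t * (t * (t * p * t⁻¹) * t⁻¹) * t⁻¹) * t⁻¹ = t ^ 4 * p * (t ^ 4)⁻¹ := by
      simp only [pow_succ, pow_zero, one_mul, mul_inv_rev, mul_assoc]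
    rw [h3, ht4] at h2
    simpa using h2
  have hsup : Subgroup.closure {x, y} ⊔ Subgroup.zpowers t = Subgroup.closure {t, x} := by
    apply le_antisymm
    · have htH : t ∈ Subgroup.closure {t, x} := Subgroup.subset_closure (by simp)
      have hxH : x ∈ Subgroup.closure {t, x} := Subgroup.subset_closure (by simp)
      rw [sup_le_iff, Subgroup.zpowers_le, Subgroup.closure_le]
      refine ⟨?_, htH⟩
      rintro q (rfl | rfl)
      · exact hxH
      · rw [← hy]
        exact mul_mem (mul_mem htH hxH) (inv_mem htH)
    · rw [Subgroup.closure_le]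
      rintro q (rfl | rfl)
      · exact Subgroup.mem_sup_right (Subgroup.mem_zpowers _)
      · exact Subgroup.mem_sup_left hxP
  have htN' : Subgroup.zpowers t ≤ Subgroup.normalizer (Subgroup.closure {x, y} : Set G) := by
    rw [Subgroup.zpowers_le]; exact htN
  refine ⟨?_, hcomm, ?_, hP9, hcube, hinf, hsup⟩
  · rw [← hsup, aux_card_sup _ _ hinf htN', hP9, Nat.card_zpowers, ht]
  · apply Subgroup.normal_subgroupOf_of_le_normalizer
    rw [← hsup, sup_le_iff]
    exact ⟨Subgroup.le_normalizer, htN'⟩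

theorem statement_6 (G : Type*) [Group G] (hG : HypHStar G)
    (a x t : G) (ha1 : a ≠ 1) (ha2 : a ^ 2 = 1)
    (hx : orderOf x = 3) (hax : a * x * a⁻¹ = x⁻¹)
    (ht : orderOf t = 4) (hta : t ^ 2 = a) :
    Nat.card (Subgroup.closure {t, x} : Subgroup G) = 36 ∧
    (∀ p ∈ Subgroup.closure {x, t * x * t⁻¹}, ∀ q ∈ Subgroup.closure {x, t * x * t⁻¹},
      p * q = q * p) ∧
    ((Subgroup.closure {x, t * x * t⁻¹}).subgroupOf (Subgroup.closure {t, x})).Normal ∧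
    Nat.card (Subgroup.closure {x, t * x * t⁻¹} : Subgroup G) = 9 ∧
    (∀ p ∈ Subgroup.closure {x, t * x * t⁻¹}, p ^ 3 = 1) ∧
    Subgroup.closure {x, t * x * t⁻¹} ⊓ Subgroup.zpowers t = ⊥ ∧
    Subgroup.closure {x, t * x * t⁻¹} ⊔ Subgroup.zpowers t = Subgroup.closure {t, x} := by
  have hx3 : x ^ 3 = 1 := by rw [← hx]; exact pow_orderOf_eq_one x
  have ht4 : t ^ 4 = 1 := by rw [← ht]; exact pow_orderOf_eq_one t
  have hx1 : x ≠ 1 := by rintro rfl; simp at hx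
  obtain ⟨y, hy⟩ : ∃ y, t * x * t⁻¹ = y := ⟨_, rfl⟩
  have hty : t * y * t⁻¹ = x⁻¹ := by
    rw [← hax, ← hta, ← hy]; simp [pow_two, mul_assoc]
  have hoy : orderOf y = 3 := by
    rw [← hy, ← hx]
    exact orderOf_injective (MulAut.conj t).toMonoidHom (MulAut.conj t).injective x
  have hy3 : y ^ 3 = 1 := by rw [← hoy]; exact pow_orderOf_eq_one y
  have hy1 : y ≠ 1 := by rintro rfl; simp at hoy
  have hay : a * y * a⁻¹ = y⁻¹ := by
    have h1 : a * y * a⁻¹ = t * (a * x * a⁻¹) * t⁻¹ := by rw [← hta, ← hy]; group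
    rw [h1, hax, ← hy]; group
  have haa : a⁻¹ = a := by rw [inv_eq_iff_mul_eq_one, ← pow_two, ha2]
  have hoa : orderOf a = 2 := orderOf_eq_prime ha2 ha1
  rw [hy]
  apply aux_final a x y t hx hax ht hta hy hty
  have hsx : (t * x) * x * (t * x)⁻¹ = y := by rw [← hy]; group
  have hsy : (t * x) * y * (t * x)⁻¹ = y * x⁻¹ * y⁻¹ := by
    rw [← hty, ← hy]; group
  have hs4 : (t * x) ^ 4 = y * x⁻¹ * y⁻¹ * x := by
    have h1 : (t * x) ^ 4 = (t * x * t⁻¹) * (t ^ 2 * x * (t ^ 2)⁻¹) *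
        (t ^ 2 * (t * x * t⁻¹) * (t ^ 2)⁻¹) * (t ^ 4 * x) := by
      simp only [pow_succ, pow_zero, one_mul]; group
    rw [h1, hta, hy, hax, hay, ht4, one_mul]
  rcases aux_orders hG (t * x) (hG.1.2.2 t x (by omega) (by omega)) with h | h | h
  · exfalso
    have hi1 : x⁻¹ * a ≠ 1 := by
      intro h'
      have : a = x := by rw [← mul_one x, ← h']; group
      rw [this] at hoa; omega
    have hj1 : a * y ≠ 1 := by
      intro h'
      have : a⁻¹ = y := inv_eq_of_mul_eq_one_right h'
      rw [haa] at this
      rw [this] at hoa; omega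
    have hax' : a * x⁻¹ * a⁻¹ = x := by
      rw [← conj_inv, hax, inv_inv]
    have hi2 : (x⁻¹ * a) ^ 2 = 1 := by
      have h1 : (x⁻¹ * a) ^ 2 = x⁻¹ * (a * x⁻¹ * a⁻¹) * a ^ 2 := by simp [pow_two, mul_assoc]
      rw [h1, hax', ha2]; group
    have hj2 : (a * y) ^ 2 = 1 := by
      have h1 : (a * y) ^ 2 = (a * y * a⁻¹) * a ^ 2 * y := by
        simp only [pow_two]; group
      rw [h1, hay, ha2]; group
    have hv9 := aux_two_invol hG hi1 hi2 hj1 hj2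
    have hv : x⁻¹ * (t * x) * x * (t * x)⁻¹ = x⁻¹ * a * (a * y) := by
      have h1 : x⁻¹ * a * (a * y) = x⁻¹ * a ^ 2 * y := by simp [pow_two, mul_assoc]
      rw [h1, ha2, ← hsx]; group
    have hv' : x⁻¹ * a * (a * y) = x⁻¹ * y := by
      have h1 : x⁻¹ * a * (a * y) = x⁻¹ * a ^ 2 * y := by simp [pow_two, mul_assoc]
      rw [h1, ha2]; group
    have hr2 : (x * ((t * x) ^ 2)⁻¹) ^ 2 = 1 := by
      have h1 : (x * ((t * x) ^ 2)⁻¹) ^ 2 =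
          t⁻¹ * (t ^ 2)⁻¹ * (t ^ 2 * x * (t ^ 2)⁻¹)⁻¹ * x⁻¹ * t⁻¹ := by
        simp [pow_two, mul_assoc]
      have h2 : t⁻¹ * (t ^ 2)⁻¹ * (x⁻¹)⁻¹ * x⁻¹ * t⁻¹ = (t ^ 4)⁻¹ := by
        simp [pow_succ, mul_assoc]
      rw [h1]
      nth_rewrite 2 3 [hta]
      rw [hax, h2, ht4, inv_one]
    have hr4 : (x * (t * x)⁻¹) ^ 4 = 1 := by
      have h1 : x * (t * x)⁻¹ = t⁻¹ := by group
      rw [h1, inv_pow, ht4, inv_one]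
    have hen := aux_enum (α := G ⧸ Subgroup.zpowers (t * x)) (t * x) x h hx3 hr2 hr4
      ((1 : G) : G ⧸ Subgroup.zpowers (t * x))
      (by
        rw [MulAction.Quotient.smul_coe, smul_eq_mul, mul_one, eq_comm, QuotientGroup.eq]
        simp)
    rw [MulAction.Quotient.smul_coe, smul_eq_mul, mul_one, eq_comm, QuotientGroup.eq, inv_one,
      one_mul, hv] at hen
    rw [pow_succ, mul_eq_one_iff_eq_inv] at hv9
    rw [hv9, inv_mem_iff, hv'] at hen
    obtain ⟨k, hk⟩ := Subgroup.mem_zpowers_iff.1 hen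
    have hcm : (t * x) * (x⁻¹ * y) * (t * x)⁻¹ = x⁻¹ * y := by
      rw [← hk, mul_inv_eq_iff_eq_mul]
      exact (Commute.refl (t * x)).zpow_right k
    have hcm2 : (t * x) * (x⁻¹ * y) * (t * x)⁻¹ = x⁻¹ * y⁻¹ := by
      have h1 : (t * x) * (x⁻¹ * y) * (t * x)⁻¹ =
        ((t * x) * x * (t * x)⁻¹)⁻¹ * ((t * x) * y * (t * x)⁻¹) := by group
      rw [h1, hsx, hsy]; group
    have hyy : y = y⁻¹ := mul_left_cancel (hcm.symm.trans hcm2)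
    have h2 : y ^ 2 = 1 := by rw [pow_two]; exact mul_eq_one_iff_eq_inv.2 hyy
    have := Nat.le_of_dvd (by norm_num) (orderOf_dvd_of_pow_eq_one h2)
    omega
  · rw [h] at hs4
    have h1 : y * x⁻¹ = x⁻¹ * y := by
      have h2 : y * x⁻¹ = (y * x⁻¹ * y⁻¹ * x) * (x⁻¹ * y) := by simp [mul_assoc]
      rw [h2, ← hs4, one_mul]
    have h2 : Commute y x⁻¹ := h1
    exact (Commute.inv_right_iff.1 h2).symm
  · exfalso
    have hb1 : (t * x) ^ 4 ≠ 1 := by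
      intro h'
      have := Nat.le_of_dvd (by norm_num) (orderOf_dvd_of_pow_eq_one h')
      omega
    have hb2 : ((t * x) ^ 4) ^ 2 = 1 := by
      rw [← pow_mul]
      exact orderOf_dvd_iff_pow_eq_one.1 (by rw [h])
    obtain ⟨b, hb⟩ : ∃ b, (t * x) ^ 4 = b := ⟨_, rfl⟩
    rw [hb] at hb1 hb2 hs4
    have hz : (y⁻¹ * b) ^ 3 = 1 := by
      have h1 : y⁻¹ * b = x⁻¹ * y⁻¹ * x⁻¹⁻¹ := by rw [hs4]; group
      rw [h1, conj_pow, inv_pow, hy3]; group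
    have hbb : b⁻¹ = b := by rw [inv_eq_iff_mul_eq_one, ← pow_two, hb2]
    have hd2 : ∀ g : G, (g * b * g⁻¹) ^ 2 = 1 := by
      intro g
      rw [conj_pow, hb2]; group
    have hd1 : ∀ g : G, g * b * g⁻¹ ≠ 1 := by
      intro g h'
      exact hb1 (conj_eq_one_iff.1 h')
    have hprod : (y⁻¹ * b * y) * (y⁻¹ * y⁻¹ * b * y * y) * (b) = 1 := by
      have h1 : (y⁻¹ * b * y) * (y⁻¹ * y⁻¹ * b * y * y) * b =
        (y⁻¹ * b) * (y⁻¹ * b) * (y ^ 3 * (y⁻¹ * b)) := by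
        simp only [pow_succ, pow_zero, one_mul]; group
      rw [h1, hy3, one_mul, ← hz, pow_succ, pow_two]
    have hcb : (y⁻¹ * b * y⁻¹⁻¹) * b = b * (y⁻¹ * b * y⁻¹⁻¹) := by
      have hcc : (y⁻¹ * b * y)⁻¹ = y⁻¹ * b * y := by simp [hbb, mul_assoc]
      have h1 : y⁻¹ * y⁻¹ * b * y * y = (y⁻¹ * b * y) * b := by
        have h2 := mul_eq_one_iff_eq_inv.1 hprod
        rw [hbb] at h2
        rw [← hcc, eq_inv_mul_iff_mul_eq, h2]
      have h3 : (y⁻¹ * y⁻¹ * b * y * y)⁻¹ = y⁻¹ * y⁻¹ * b * y * y := by simp [hbb, mul_assoc]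
      rw [h1, mul_inv_rev, hcc, hbb] at h3
      rw [inv_inv]
      exact h3.symm
    have heq := aux_comm_invol hG (hd1 y⁻¹) (hd2 y⁻¹) hb1 hb2 hcb
    have hby : b * y = y * b := by
      have h1 := mul_inv_eq_iff_eq_mul.1 heq
      have h2 : y * (y⁻¹ * b) * y = y * (b * y⁻¹) * y := by rw [h1]
      simpa [mul_assoc] using h2
    exact aux_no_three hG hb1 hb2 hby (by rw [hoy])
end
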